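/- arXiv:1904.10336 — 2 statements merged into one kernel-verified Lean document; each statement's English description precedes it below -/
import Mathlib

section
/- Let L be a first-order language, T an L-theory, and φ(x,y) an L-formula that is stable in T. Let M ⊨ T, let A ⊆ M^y be any set, and let p be a φ-type over A. Then p is definable over A by an instance of a stable formula: there exist an L-formula ψ(y,z) which is stable in T, with z a finite tuple of single variables, and a tuple c of elements of M each of which occurs as a coordinate of some tuple in A, such that for all a ∈ A: M ⊨ ψ(a,c) if and only if φ(x,a) ∈ p. -/
open FirstOrder Language

universe u v

/-- `φ(x, y)` is stable in `T`: there is `n` such that no model of `T` contains an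
order-witnessing ladder `(b_i, a_j)_{i,j < n}` for `φ`. -/
def FormulaStable {L : FirstOrder.Language.{u, v}} {α β : Type*} (T : L.Theory)
    (φ : L.Formula (α ⊕ β)) : Prop :=
  ∃ n : ℕ, ∀ (N : Type (max u v)) [L.Structure N] [Nonempty N], N ⊨ T →
    ∀ (b : Fin n → α → N) (a : Fin n → β → N),
      ¬ ∀ i j : Fin n, (φ.Realize (Sum.elim (b i) (a j)) ↔ i ≤ j)

/-- `p` (given as the set of parameters `a ∈ A` with `φ(x,a) ∈ p`) is a (consistent,
complete) `φ`-type over `A`: every finite fragment of it is realized in `M`. -/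
def IsPhiType {L : FirstOrder.Language.{u, v}} {α β : Type*} {M : Type (max u v)}
    [L.Structure M] (φ : L.Formula (α ⊕ β)) (A : Set (β → M)) (p : Set (β → M)) :
    Prop :=
  p ⊆ A ∧ ∀ A₀ : Finset (β → M), ↑A₀ ⊆ A →
    ∃ b : α → M, ∀ a ∈ A₀, (φ.Realize (Sum.elim b a) ↔ a ∈ p)

section Combinatorics

variable {X Y : Type*} {R : X → Y → Prop}

/-- The complete binary tree of height `h` embeds in `S`, splitting by fibres of `R` over
parameters in `W`. -/
def HasTree (R : X → Y → Prop) : ℕ → Set Y → Set X → Prop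
  | 0, _, S => S.Nonempty
  | h + 1, W, S => ∃ y ∈ W, HasTree R h W (S ∩ {x | R x y}) ∧ HasTree R h W (S ∩ {x | ¬ R x y})

theorem HasTree.mono {h : ℕ} {W : Set Y} {S S' : Set X} (H : HasTree R h W S) (hS : S ⊆ S') :
    HasTree R h W S' := by
  induction h generalizing S S' with
  | zero => exact Set.Nonempty.mono hS H
  | succ h ih =>
    obtain ⟨y, hy, h1, h2⟩ := H
    exact ⟨y, hy, ih h1 (Set.inter_subset_inter_left _ hS),
      ih h2 (Set.inter_subset_inter_left _ hS)⟩

theorem HasTree.nonempty {h : ℕ} {W : Set Y} {S : Set X} (H : HasTree R h W S) :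
    S.Nonempty := by
  induction h generalizing S with
  | zero => exact H
  | succ h ih =>
    obtain ⟨y, -, h1, -⟩ := H
    exact (ih h1).mono Set.inter_subset_left

theorem HasTree.split_params {t h₁ h₂ : ℕ} {W : Set Y} {S : Set X} (V : Set Y)
    (ht : h₁ + h₂ = t) (H : HasTree R t W S) :
    HasTree R h₁ (W ∩ V) S ∨ HasTree R h₂ (W \ V) S := by
  induction t generalizing h₁ h₂ S with
  | zero =>
    obtain rfl : h₁ = 0 := by omega
    exact Or.inl H
  | succ t ih =>
    rcases h₁ with _ | h₁
    · exact Or.inl H.nonempty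
    rcases h₂ with _ | h₂
    · exact Or.inr H.nonempty
    obtain ⟨y, hy, h1, h2⟩ := H
    by_cases hV : y ∈ V
    · rcases ih (h₁ := h₁) (h₂ := h₂ + 1) (by omega) h1 with h1 | h1
      · rcases ih (h₁ := h₁) (h₂ := h₂ + 1) (by omega) h2 with h2 | h2
        · exact Or.inl ⟨y, ⟨hy, hV⟩, h1, h2⟩
        · exact Or.inr (h2.mono Set.inter_subset_left)
      · exact Or.inr (h1.mono Set.inter_subset_left)
    · rcases ih (h₁ := h₁ + 1) (h₂ := h₂) (by omega) h1 with h1 | h1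
      · exact Or.inl (h1.mono Set.inter_subset_left)
      · rcases ih (h₁ := h₁ + 1) (h₂ := h₂) (by omega) h2 with h2 | h2
        · exact Or.inl (h2.mono Set.inter_subset_left)
        · exact Or.inr ⟨y, ⟨hy, hV⟩, h1, h2⟩

/-- There is a ladder of length `l` for `R` with rungs in `S` and `W`. -/
def HasLadder (R : X → Y → Prop) (l : ℕ) (W : Set Y) (S : Set X) : Prop :=
  ∃ (b : Fin l → X) (a : Fin l → Y), (∀ i, b i ∈ S) ∧ (∀ j, a j ∈ W) ∧
    ∀ i j, R (b i) (a j) ↔ i ≤ j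

/-- There is a strict ladder of length `l` for `R` with rungs in `S` and `W`. -/
def HasStrictLadder (R : X → Y → Prop) (l : ℕ) (W : Set Y) (S : Set X) : Prop :=
  ∃ (b : Fin l → X) (a : Fin l → Y), (∀ i, b i ∈ S) ∧ (∀ j, a j ∈ W) ∧
    ∀ i j, R (b i) (a j) ↔ i < j

theorem HasLadder.mono {l : ℕ} {W W' : Set Y} {S S' : Set X} (H : HasLadder R l W S)
    (hW : W ⊆ W') (hS : S ⊆ S') : HasLadder R l W' S' := by
  obtain ⟨b, a, hb, ha, h⟩ := H
  exact ⟨b, a, fun i => hS (hb i), fun j => hW (ha j), h⟩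

theorem HasStrictLadder.mono {l : ℕ} {W W' : Set Y} {S S' : Set X}
    (H : HasStrictLadder R l W S) (hW : W ⊆ W') (hS : S ⊆ S') : HasStrictLadder R l W' S' := by
  obtain ⟨b, a, hb, ha, h⟩ := H
  exact ⟨b, a, fun i => hS (hb i), fun j => hW (ha j), h⟩

theorem HasLadder.cons {l : ℕ} {W : Set Y} {S : Set X} {b₀ : X} {a₀ : Y}
    (hb₀ : b₀ ∈ S) (ha₀ : a₀ ∈ W) (h₀ : R b₀ a₀)
    (H : HasLadder R l (W ∩ {y | R b₀ y}) (S ∩ {x | ¬ R x a₀})) : HasLadder R (l + 1) W S := by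
  obtain ⟨b, a, hb, ha, h⟩ := H
  refine ⟨Fin.cons b₀ b, Fin.cons a₀ a, ?_, ?_, ?_⟩
  · exact Fin.cases hb₀ fun i => (hb i).1
  · exact Fin.cases ha₀ fun i => (ha i).1
  · refine Fin.cases (Fin.cases ?_ fun j => ?_) fun i => Fin.cases ?_ fun j => ?_
    · simpa using h₀
    · simpa using (ha j).2
    · simpa using (hb i).2
    · simpa using h i j

theorem HasStrictLadder.snoc {l : ℕ} {W : Set Y} {S : Set X} {b₀ : X} {a₀ : Y}
    (hb₀ : b₀ ∈ S) (ha₀ : a₀ ∈ W) (h₀ : ¬ R b₀ a₀)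
    (H : HasStrictLadder R l (W ∩ {y | ¬ R b₀ y}) (S ∩ {x | R x a₀})) :
    HasStrictLadder R (l + 1) W S := by
  obtain ⟨b, a, hb, ha, h⟩ := H
  refine ⟨Fin.snoc b b₀, Fin.snoc a a₀, ?_, ?_, ?_⟩
  · exact Fin.lastCases (by simpa using hb₀) fun i => by simpa using (hb i).1
  · exact Fin.lastCases (by simpa using ha₀) fun i => by simpa using (ha i).1
  · refine Fin.lastCases (Fin.lastCases ?_ fun j => ?_) fun i => Fin.lastCases ?_ fun j => ?_
    · simpa using h₀
    · simpa [(Fin.castSucc_lt_last j).not_gt] using (ha j).2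
    · simpa [Fin.castSucc_lt_last] using (hb i).2
    · simpa using h i j

theorem exists_hasTree_imp_ladder (t : ℕ) : ∃ h, ∀ (X Y : Type*) (R : X → Y → Prop) (l r : ℕ),
    l + r = t → ∀ (W : Set Y) (S : Set X), HasTree R h W S →
      HasLadder R l W S ∨ HasStrictLadder R r W S := by
  induction t with
  | zero =>
    refine ⟨0, fun X Y R l r hlr W S _ => ?_⟩
    obtain rfl : l = 0 := by omega
    exact Or.inl ⟨Fin.elim0, Fin.elim0, fun i => i.elim0, fun i => i.elim0, fun i => i.elim0⟩
  | succ t ih =>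
    obtain ⟨h, ih⟩ := ih
    refine ⟨(h + 1) + (h + 1), fun X Y R l r hlr W S H => ?_⟩
    rcases l with _ | l
    · exact Or.inl ⟨Fin.elim0, Fin.elim0, fun i => i.elim0, fun i => i.elim0, fun i => i.elim0⟩
    rcases r with _ | r
    · exact Or.inr ⟨Fin.elim0, Fin.elim0, fun i => i.elim0, fun i => i.elim0, fun i => i.elim0⟩
    obtain ⟨b, hb⟩ := H.nonempty
    rcases H.split_params {y | R b y} rfl with ⟨a, ha, -, h2⟩ | ⟨a, ha, h1, -⟩
    · rcases ih X Y R l (r + 1) (by omega) _ _ h2 with H' | H'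
      · exact Or.inl (H'.cons hb ha.1 ha.2)
      · exact Or.inr (H'.mono Set.inter_subset_left Set.inter_subset_left)
    · rcases ih X Y R (l + 1) r (by omega) _ _ h1 with H' | H'
      · exact Or.inl (H'.mono Set.sdiff_subset Set.inter_subset_left)
      · exact Or.inr (H'.snoc hb ha.1 ha.2)

theorem exists_not_hasTree {m : ℕ} (hR : ∀ (b : Fin m → X) (a : Fin m → Y),
    ¬ ∀ i j, R (b i) (a j) ↔ i ≤ j) : ∃ h, ¬ HasTree R h Set.univ Set.univ := by
  obtain ⟨h, hh⟩ := exists_hasTree_imp_ladder (m + (m + 1))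
  refine ⟨h, fun H => ?_⟩
  rcases hh X Y R m (m + 1) rfl _ _ H with ⟨b, a, -, -, hba⟩ | ⟨b, a, -, -, hba⟩
  · exact hR b a hba
  · exact hR (fun i => b i.castSucc) (fun j => a j.succ) fun i j => by
      rw [hba, Fin.castSucc_lt_succ_iff]

/-- `Large R N n k S` says that `S` splits, by fibres of `R`, into `k` pieces of rank at
least `n`, where a set has rank at least `n + 1` if it splits into `N` pieces of rank at
least `n`, and rank at least `0` if it is nonempty. -/
inductive Large (R : X → Y → Prop) (N : ℕ) : ℕ → ℕ → Set X → Prop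
  | base {S : Set X} (hS : S.Nonempty) : Large R N 0 1 S
  | up {n : ℕ} {S : Set X} (h : Large R N n N S) : Large R N (n + 1) 1 S
  | add {n k l : ℕ} {S : Set X} (y : Y) (h₁ : Large R N n k (S ∩ {x | R x y}))
      (h₂ : Large R N n l (S ∩ {x | ¬ R x y})) : Large R N n (k + l) S

namespace Large

variable {N n k l : ℕ} {S S' : Set X}

theorem pos (H : Large R N n k S) : 1 ≤ k := by
  induction H <;> omega

theorem mono (H : Large R N n k S) (hS : S ⊆ S') : Large R N n k S' := by
  induction H generalizing S' with
  | base h => exact .base (h.mono hS)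
  | up _ ih => exact .up (ih hS)
  | add y _ _ ih₁ ih₂ =>
    exact .add y (ih₁ (Set.inter_subset_inter_left _ hS)) (ih₂ (Set.inter_subset_inter_left _ hS))

theorem of_le (H : Large R N n k S) (hl : 1 ≤ l) (hlk : l ≤ k) : Large R N n l S := by
  induction H generalizing l with
  | base h =>
    obtain rfl : l = 1 := by omega
    exact .base h
  | up h _ =>
    obtain rfl : l = 1 := by omega
    exact .up h
  | @add n k₁ k₂ S y h₁ h₂ ih₁ ih₂ =>
    by_cases h : l ≤ k₁
    · exact (ih₁ hl h).mono Set.inter_subset_left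
    · obtain ⟨d, rfl⟩ := Nat.exists_eq_add_of_lt (not_le.1 h)
      rw [add_assoc]
      exact .add y h₁ (ih₂ (by omega) (by omega))

theorem one_iff_zero : Large R N 0 1 S ↔ S.Nonempty := by
  refine ⟨fun H => ?_, .base⟩
  generalize hk : 1 = k at H
  cases H with
  | base h => exact h
  | add y h₁ h₂ => have := h₁.pos; have := h₂.pos; omega

theorem one_iff_succ : Large R N (n + 1) 1 S ↔ Large R N n N S := by
  refine ⟨fun H => ?_, .up⟩
  generalize hn : n + 1 = n' at H
  generalize hk : 1 = k at H
  cases H with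
  | base => omega
  | up h => exact Nat.succ_injective hn ▸ h
  | add y h₁ h₂ => have := h₁.pos; have := h₂.pos; omega

theorem add_two_iff : Large R N n (k + 2) S ↔ ∃ i : Fin (k + 1), ∃ y,
    Large R N n (i + 1) (S ∩ {x | R x y}) ∧ Large R N n (k + 1 - i) (S ∩ {x | ¬ R x y}) := by
  constructor
  · intro H
    generalize hk : k + 2 = k' at H
    cases H with
    | base => omega
    | up => omega
    | @add _ k₁ k₂ _ y h₁ h₂ =>
      have p₁ := h₁.pos
      have p₂ := h₂.pos
      refine ⟨⟨k₁ - 1, by omega⟩, y, ?_, ?_⟩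
      · rwa [show k₁ - 1 + 1 = k₁ by omega]
      · rwa [show k + 1 - (k₁ - 1) = k₂ by omega]
  · rintro ⟨i, y, h₁, h₂⟩
    have := Large.add y h₁ h₂
    rwa [show (i : ℕ) + 1 + (k + 1 - i) = k + 2 by omega] at this

theorem hasTree (H : Large R 2 n k S) :
    HasTree R n Set.univ S ∧ (2 ≤ k → HasTree R (n + 1) Set.univ S) := by
  induction H with
  | base h => exact ⟨h, by omega⟩
  | up _ ih => exact ⟨ih.2 le_rfl, by omega⟩
  | add y _ _ ih₁ ih₂ =>
    exact ⟨ih₁.1.mono Set.inter_subset_left, fun _ => ⟨y, trivial, ih₁.1, ih₂.1⟩⟩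

theorem zero_or_add {y : Y} (h₁ : k = 0 ∨ Large R N n k (S ∩ {x | R x y}))
    (h₂ : l = 0 ∨ Large R N n l (S ∩ {x | ¬ R x y})) : k + l = 0 ∨ Large R N n (k + l) S := by
  rcases h₁ with rfl | h₁ <;> rcases h₂ with rfl | h₂
  · exact Or.inl rfl
  · rw [zero_add]
    exact Or.inr (h₂.mono Set.inter_subset_left)
  · exact Or.inr (h₁.mono Set.inter_subset_left)
  · exact Or.inr (.add y h₁ h₂)

end Large

open Classical in
theorem Multiset.exists_mem_forall_le_countP {N : ℕ} (hN : 1 ≤ N) (F : Finset Y)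
    (m : Multiset X) (hm : 2 ^ F.card * N ≤ m.card) :
    ∃ x ∈ m, ∀ y ∈ F, N ≤ m.countP fun x' => R x' y ↔ R x y := by
  induction F using Finset.induction_on generalizing m with
  | empty =>
    obtain ⟨x, hx⟩ := Multiset.card_pos_iff_exists_mem.1 (show 0 < m.card by simp at hm; omega)
    exact ⟨x, hx, by simp⟩
  | insert y F hy ih =>
    rw [Finset.card_insert_of_notMem hy, pow_succ] at hm
    have hsum := congrArg Multiset.card (Multiset.filter_add_not (fun x => R x y) m)
    rw [Multiset.card_add] at hsum
    have key : ∃ m' ≤ m, 2 ^ F.card * N ≤ m'.card ∧ ∀ x ∈ m', ∀ x' ∈ m', R x' y ↔ R x y := by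
      by_cases h : 2 ^ F.card * N ≤ (m.filter fun x => R x y).card
      · refine ⟨_, Multiset.filter_le _ _, h, fun x hx x' hx' => ?_⟩
        simp [(Multiset.mem_filter.1 hx).2, (Multiset.mem_filter.1 hx').2]
      · refine ⟨m.filter fun x => ¬ R x y, Multiset.filter_le _ _, by nlinarith,
          fun x hx x' hx' => ?_⟩
        simp [(Multiset.mem_filter.1 hx).2, (Multiset.mem_filter.1 hx').2]
    obtain ⟨m', hle, hcard, hsame⟩ := key
    obtain ⟨x, hx, hF⟩ := ih m' hcard
    refine ⟨x, Multiset.mem_of_le hle hx, fun z hz => ?_⟩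
    refine le_trans ?_ (Multiset.countP_le_of_le _ hle)
    rcases Finset.mem_insert.1 hz with rfl | hz
    · rw [Multiset.countP_eq_card.2 (hsame x hx)]
      exact le_trans (Nat.le_mul_of_pos_left _ (by positivity)) hcard
    · exact hF z hz

open Classical in
/-- A set with `k` sufficiently large pieces contains `k` points which, for finitely many
given parameters, are as distributed as the pieces are. -/
theorem Large.exists_points {N n k : ℕ} {S : Set X} (hN : 1 ≤ N) (F : Finset Y)
    (H : Large R (2 ^ F.card * N) n k S) : ∃ m : Multiset X, m.card = k ∧ ∀ y ∈ F,
      ((m.countP fun x => R x y) = 0 ∨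
        Large R N n (m.countP fun x => R x y) (S ∩ {x | R x y})) ∧
      ((m.countP fun x => ¬ R x y) = 0 ∨
        Large R N n (m.countP fun x => ¬ R x y) (S ∩ {x | ¬ R x y})) := by
  induction H with
  | base h =>
    obtain ⟨x, hx⟩ := h
    refine ⟨{x}, by simp, fun y _ => ?_⟩
    by_cases hxy : R x y
    · have : Large R N 0 1 (_ ∩ {x | R x y}) := .base ⟨x, hx, hxy⟩
      simp [hxy, this, ← Multiset.cons_zero]
    · have : Large R N 0 1 (_ ∩ {x | ¬ R x y}) := .base ⟨x, hx, hxy⟩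
      simp [hxy, this, ← Multiset.cons_zero]
  | @up n S _ ih =>
    obtain ⟨m, hm, hF⟩ := ih
    obtain ⟨x, hx, hxF⟩ := Multiset.exists_mem_forall_le_countP (R := R) hN F m hm.ge
    refine ⟨{x}, by simp, fun y hy => ?_⟩
    have hc := hxF y hy
    obtain ⟨h₁, h₂⟩ := hF y hy
    by_cases hxy : R x y
    · simp only [hxy, iff_true] at hc
      have : Large R N (n + 1) 1 (S ∩ {x | R x y}) :=
        .up ((h₁.resolve_left (by omega)).of_le hN hc)
      simp [hxy, this, ← Multiset.cons_zero]
    · simp only [hxy, iff_false] at hc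
      have : Large R N (n + 1) 1 (S ∩ {x | ¬ R x y}) :=
        .up ((h₂.resolve_left (by omega)).of_le hN hc)
      simp [hxy, this, ← Multiset.cons_zero]
  | add z _ _ ih₁ ih₂ =>
    obtain ⟨m₁, hm₁, hF₁⟩ := ih₁
    obtain ⟨m₂, hm₂, hF₂⟩ := ih₂
    refine ⟨m₁ + m₂, by simp [hm₁, hm₂], fun y hy => ?_⟩
    obtain ⟨h₁, h₁'⟩ := hF₁ y hy
    obtain ⟨h₂, h₂'⟩ := hF₂ y hy
    rw [Multiset.countP_add, Multiset.countP_add]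
    rw [Set.inter_right_comm] at h₁ h₁' h₂ h₂'
    exact ⟨Large.zero_or_add h₁ h₂, Large.zero_or_add h₁' h₂'⟩

/-- If `S` has exactly `k` pieces of rank `n`, then the set of parameters over which the
fibre has rank `n` is, on finite sets, a union of `k` sets `{y | R x y}`. -/
theorem Large.exists_union {N n k : ℕ} {S : Set X} (hN : 1 ≤ N) (hk : 1 ≤ k)
    (H : ∀ N', 1 ≤ N' → Large R N' n k S) (H' : ¬ Large R N n (k + 1) S) (F : Finset Y) :
    ∃ x : Fin k → X, ∀ y ∈ F, Large R N n 1 (S ∩ {x | R x y}) ↔ ∃ i, R (x i) y := by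
  classical
  obtain ⟨m, hm, hF⟩ := (H (2 ^ F.card * N) (Nat.mul_pos (by positivity) hN)).exists_points hN F
  obtain ⟨x, hx⟩ : ∃ x : Fin k → X, ∀ z, z ∈ m ↔ ∃ i, x i = z := by
    refine ⟨fun i => m.toList.get (i.cast (by simp [hm])), fun z => ?_⟩
    rw [← Multiset.mem_toList, List.mem_iff_get]
    constructor
    · rintro ⟨i, hi⟩
      exact ⟨i.cast (by simp [hm]), hi⟩
    · rintro ⟨i, hi⟩
      exact ⟨_, hi⟩
  refine ⟨x, fun y hy => ?_⟩
  obtain ⟨h₁, h₂⟩ := hF y hy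
  have hpos : 0 < (m.countP fun x => R x y) ↔ ∃ i, R (x i) y := by
    rw [Multiset.countP_pos]
    simp only [hx]
    constructor
    · rintro ⟨_, ⟨i, rfl⟩, h⟩
      exact ⟨i, h⟩
    · rintro ⟨i, h⟩
      exact ⟨_, ⟨i, rfl⟩, h⟩
  rw [← hpos]
  constructor
  · intro hy'
    by_contra h0
    have hcard := Multiset.card_eq_countP_add_countP (fun x => R x y) m
    rw [Nat.eq_zero_of_not_pos h0, zero_add, hm] at hcard
    rw [← hcard] at h₂
    exact H' (add_comm 1 k ▸ .add y hy' (h₂.resolve_left (by omega)))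
  · intro h
    exact (h₁.resolve_left h.ne').of_le le_rfl h

/-- Ramsey's theorem for pairs, with prescribed sizes of the homogeneous sets. -/
theorem exists_forall_homogeneous (ι : Type) [Fintype ι] [Nonempty ι] (t : ℕ) :
    ∃ m : ℕ, ∀ (α : Type) [LinearOrder α] (c : α → α → ι) (l : ι → ℕ), ∑ s, l s = t →
      ∀ J : Finset α, m ≤ J.card →
        ∃ s, ∃ I ⊆ J, l s ≤ I.card ∧ ∀ i ∈ I, ∀ j ∈ I, j < i → c i j = s := by
  classical
  induction t with
  | zero =>
    refine ⟨0, fun α _ c l hl J _ => ?_⟩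
    obtain ⟨s⟩ := ‹Nonempty ι›
    exact ⟨s, ∅, by simp, by simp [Finset.sum_eq_zero_iff.1 hl s], by simp⟩
  | succ t ih =>
    obtain ⟨m, ih⟩ := ih
    refine ⟨Fintype.card ι * m + 1, fun α _ c l hl J hJ => ?_⟩
    have hne : J.Nonempty := Finset.card_pos.1 (by omega)
    set top := J.max' hne with htop
    have htopmem : top ∈ J := J.max'_mem hne
    have hcard : (Finset.univ : Finset ι).card * m ≤ (J.erase top).card := by
      rw [Finset.card_erase_of_mem htopmem, Finset.card_univ]
      omega
    obtain ⟨s, -, hs⟩ := Finset.exists_le_card_fiber_of_mul_le_card_of_maps_to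
      (f := c top) (fun _ _ => Finset.mem_univ _) Finset.univ_nonempty hcard
    by_cases hls : l s = 0
    · exact ⟨s, ∅, by simp, by simp [hls], by simp⟩
    have hsum : ∑ i, Function.update l s (l s - 1) i = t := by
      rw [Finset.sum_update_of_mem (Finset.mem_univ s)]
      have := Finset.add_sum_erase Finset.univ l (Finset.mem_univ s)
      rw [Finset.sdiff_singleton_eq_erase]
      omega
    obtain ⟨s', I, hI, hIc, hIh⟩ := ih α c _ hsum _ hs
    have hIJ : ∀ i ∈ I, (i ≠ top ∧ i ∈ J) ∧ c top i = s := fun i hi => by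
      simpa using hI hi
    by_cases hss : s' = s
    · subst hss
      refine ⟨s', insert top I, ?_, ?_, ?_⟩
      · exact Finset.insert_subset htopmem fun i hi => (hIJ i hi).1.2
      · rw [Finset.card_insert_of_notMem fun h => (hIJ _ h).1.1 rfl]
        simp at hIc
        omega
      · intro i hi j hj hji
        rcases Finset.mem_insert.1 hi with rfl | hi
        · rcases Finset.mem_insert.1 hj with rfl | hj
          · exact absurd hji (lt_irrefl _)
          · exact (hIJ j hj).2
        · rcases Finset.mem_insert.1 hj with rfl | hj
          · exact absurd hji (not_lt.2 (J.le_max' i (hIJ i hi).1.2))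
          · exact hIh i hi j hj hji
    · exact ⟨s', I, fun i hi => (hIJ i hi).1.2, by simpa [hss] using hIc, hIh⟩

/-- A bound on ladders for `R` gives a bound on (reversed) ladders for the disjunction of
`k` copies of `R`. -/
theorem exists_bound_disjunction (k n : ℕ) (hk : 1 ≤ k) : ∃ m : ℕ, ∀ (X Y : Type*)
    (R : X → Y → Prop), (∀ (b : Fin n → X) (a : Fin n → Y), ¬ ∀ i j, R (b i) (a j) ↔ i ≤ j) →
      ∀ (x : Fin m → Fin k → X) (y : Fin m → Y),
        ¬ ∀ i j, (∃ s, R (x j s) (y i)) ↔ i ≤ j := by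
  have : Nonempty (Fin k) := ⟨⟨0, hk⟩⟩
  obtain ⟨m, hm⟩ := exists_forall_homogeneous (Fin k) (∑ _s : Fin k, 2 * n)
  refine ⟨m, fun X Y R hR x y hxy => ?_⟩
  have hc : ∀ j i, ∃ s, i ≤ j → R (x j s) (y i) := fun j i => by
    by_cases h : i ≤ j
    · obtain ⟨s, hs⟩ := (hxy i j).2 h
      exact ⟨s, fun _ => hs⟩
    · exact ⟨⟨0, hk⟩, fun h' => absurd h' h⟩
  choose c hc using hc
  obtain ⟨s, I, -, hI, hIh⟩ := hm (Fin m) c (fun _ => 2 * n) rfl Finset.univ (by simp)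
  let e := I.orderEmbOfCardLe hI
  have he : ∀ i, e i ∈ I := I.orderEmbOfCardLe_mem hI
  refine hR (fun i => x (e ⟨2 * i.rev + 1, by omega⟩) s) (fun j => y (e ⟨2 * j.rev, by omega⟩))
    fun i j => ?_
  rw [← Fin.rev_le_rev]
  constructor
  · intro h
    have h1 := (hxy _ _).1 ⟨s, h⟩
    rw [e.le_iff_le, Fin.mk_le_mk] at h1
    exact Fin.le_def.2 (by omega)
  · intro h
    have h1 : e ⟨2 * j.rev, by omega⟩ < e ⟨2 * i.rev + 1, by omega⟩ := by
      rw [e.lt_iff_lt, Fin.mk_lt_mk]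
      have := Fin.le_def.1 h
      omega
    have h2 := hc _ _ h1.le
    rwa [hIh _ (he _) _ (he _) h1] at h2

theorem exists_holds_not_succ {P : ℕ → Prop} {a b : ℕ} (ha : P a) (hb : ¬ P b) (hab : a ≤ b) :
    ∃ n, a ≤ n ∧ P n ∧ ¬ P (n + 1) := by
  by_contra! H
  exact hb (Nat.le_induction ha H b hab)

open Classical in
/-- A finitely consistent set of conditions for a relation without long ladders contains a
finite part with a well-defined rank `n` and multiplicity `k`, both of which are attained by
every larger finite part. -/
theorem exists_rank_multiplicity {m : ℕ} (hR : ∀ (b : Fin m → X) (a : Fin m → Y),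
    ¬ ∀ i j, R (b i) (a j) ↔ i ≤ j) (A p : Set Y)
    (hp : ∀ F : Finset Y, ↑F ⊆ A → ∃ b, ∀ a ∈ F, R b a ↔ a ∈ p) :
    ∃ (n k N : ℕ) (F₀ : Finset Y), 1 ≤ k ∧ 1 ≤ N ∧ ↑F₀ ⊆ A ∧
      (∀ F : Finset Y, ↑F ⊆ A → ∀ N', 1 ≤ N' →
        Large R N' n k {x | ∀ a ∈ F, R x a ↔ a ∈ p}) ∧
      ¬ Large R N n (k + 1) {x | ∀ a ∈ F₀, R x a ↔ a ∈ p} := by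
  let P : ℕ → ℕ → Prop := fun n k => ∀ F : Finset Y, ↑F ⊆ A → ∀ N', 1 ≤ N' →
    Large R N' n k {x | ∀ a ∈ F, R x a ↔ a ∈ p}
  obtain ⟨h, hh⟩ := exists_not_hasTree hR
  obtain ⟨n, -, hn, hn'⟩ := exists_holds_not_succ (P := fun n => P n 1) (a := 0) (b := h)
    (fun F hF _ _ => .base (hp F hF))
    (fun H => hh ((H ∅ (by simp) 2 (by omega)).hasTree.1.mono (Set.subset_univ _))) (zero_le)
  simp only [P, not_forall] at hn'
  obtain ⟨F₁, hF₁, N₁, hN₁, hlarge⟩ := hn'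
  obtain ⟨k, hk, hPk, hPk'⟩ := exists_holds_not_succ (P := P n) hn
    (fun H => hlarge (.up (H F₁ hF₁ N₁ hN₁))) hN₁
  simp only [P, not_forall] at hPk'
  obtain ⟨F₀, hF₀, N, hN, hlarge⟩ := hPk'
  exact ⟨n, k, N, F₀, hk, hN, hF₀, hPk, hlarge⟩

end Combinatorics

section Formulas

open FirstOrder.Language

/-- Largeness is a definable condition on parameters. -/
theorem exists_formula_large {L : FirstOrder.Language.{u, v}} {nx ny : ℕ}
    (φ : L.Formula (Fin nx ⊕ Fin ny)) (M : Type*) [L.Structure M] (N n k : ℕ) (β : Type)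
    (θ : L.Formula (Fin nx ⊕ β)) : ∃ χ : L.Formula β, ∀ v : β → M, χ.Realize v ↔
      Large (fun (x : Fin nx → M) (y : Fin ny → M) => φ.Realize (Sum.elim x y)) N n k
        {x | θ.Realize (Sum.elim x v)} := by
  have step : ∀ n, (∀ (β : Type) (θ : L.Formula (Fin nx ⊕ β)), ∃ χ : L.Formula β, ∀ v : β → M,
      χ.Realize v ↔ Large (fun (x : Fin nx → M) (y : Fin ny → M) => φ.Realize (Sum.elim x y))
        N n 1 {x | θ.Realize (Sum.elim x v)}) → ∀ (k : ℕ) (β : Type) (θ : L.Formula (Fin nx ⊕ β)),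
      ∃ χ : L.Formula β, ∀ v : β → M, χ.Realize v ↔
        Large (fun (x : Fin nx → M) (y : Fin ny → M) => φ.Realize (Sum.elim x y))
          N n k {x | θ.Realize (Sum.elim x v)} := by
    intro n h1 k
    induction k using Nat.strong_induction_on with
    | _ k ih =>
    intro β θ
    rcases k with _ | _ | k
    · exact ⟨⊥, fun v => ⟨fun h => h.elim, fun h => absurd h.pos (by omega)⟩⟩
    · exact h1 β θ
    · choose χ₁ hχ₁ using fun i : Fin (k + 1) => ih (i + 1) (by omega) (β ⊕ Fin ny)
        (θ.relabel (Sum.map id Sum.inl) ⊓ φ.relabel (Sum.map id Sum.inr))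
      choose χ₂ hχ₂ using fun i : Fin (k + 1) => ih (k + 1 - i) (by omega) (β ⊕ Fin ny)
        (θ.relabel (Sum.map id Sum.inl) ⊓ (φ.relabel (Sum.map id Sum.inr)).not)
      refine ⟨Formula.iSup fun i => (χ₁ i ⊓ χ₂ i).iExs (Fin ny), fun v => ?_⟩
      rw [Large.add_two_iff, Formula.realize_iSup]
      refine exists_congr fun i => ?_
      refine Formula.realize_iExs.trans (exists_congr fun y => ?_)
      rw [Formula.realize_inf, hχ₁, hχ₂]
      simp only [Formula.realize_inf, Formula.realize_not, Formula.realize_relabel,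
        Sum.elim_comp_map, Function.comp_id, Sum.elim_comp_inl, Sum.elim_comp_inr]
      rfl
  induction n generalizing k β with
  | zero =>
    refine step 0 (fun β θ => ⟨(θ.relabel Sum.swap).iExs (Fin nx), fun v => ?_⟩) k β θ
    rw [Large.one_iff_zero, Formula.realize_iExs]
    refine exists_congr fun x => ?_
    rw [Formula.realize_relabel, Set.mem_ofPred_eq]
    simp
  | succ n ih =>
    refine step (n + 1) (fun β θ => ?_) k β θ
    obtain ⟨χ, hχ⟩ := ih N β θ
    exact ⟨χ, fun v => by rw [hχ, Large.one_iff_succ]⟩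

/-- The condition on `z` that, on any `m` tuples, `ψ(-, z)` agrees with a disjunction of `k`
instances of `φ`. -/
noncomputable def agreesWithDisjunctions {L : FirstOrder.Language.{u, v}} {α β γ : Type}
    [Finite α] [Finite β] (φ : L.Formula (α ⊕ β)) (ψ : L.Formula (β ⊕ γ)) (m k : ℕ) :
    L.Formula γ :=
  Formula.iAlls (Fin m × β) <| Formula.iExs (Fin k × α) <| Formula.iInf fun l : Fin m =>
    (ψ.relabel (Sum.elim (fun j => Sum.inl (Sum.inr (l, j))) fun g => Sum.inl (Sum.inl g))).iff
      (Formula.iSup fun i : Fin k =>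
        φ.relabel (Sum.elim (fun j => Sum.inr (i, j)) fun j => Sum.inl (Sum.inr (l, j))))

theorem realize_agreesWithDisjunctions {L : FirstOrder.Language.{u, v}} {α β γ : Type}
    [Finite α] [Finite β] (φ : L.Formula (α ⊕ β)) (ψ : L.Formula (β ⊕ γ)) (m k : ℕ)
    {M : Type*} [L.Structure M] (c : γ → M) :
    (agreesWithDisjunctions φ ψ m k).Realize c ↔ ∀ y : Fin m → β → M, ∃ x : Fin k → α → M,
      ∀ l, ψ.Realize (Sum.elim (y l) c) ↔ ∃ i, φ.Realize (Sum.elim (x i) (y l)) := by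
  rw [agreesWithDisjunctions, Formula.realize_iAlls, (Equiv.curry _ _ _).forall_congr_left]
  refine forall_congr' fun y => ?_
  rw [Formula.realize_iExs, (Equiv.curry _ _ _).exists_congr_left]
  refine exists_congr fun x => ?_
  rw [Formula.realize_iInf]
  refine forall_congr' fun l => ?_
  rw [Formula.realize_iff, Formula.realize_iSup]
  simp only [Formula.realize_relabel, Sum.comp_elim]
  rfl

theorem formulaStable_inf_agreesWithDisjunctions {L : FirstOrder.Language.{u, v}} {T : L.Theory}
    {α β γ : Type} [Finite α] [Finite β] {φ : L.Formula (α ⊕ β)} (hφ : FormulaStable T φ)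
    {k : ℕ} (hk : 1 ≤ k) : ∃ m, ∀ ψ : L.Formula (β ⊕ γ),
      FormulaStable T (ψ ⊓ (agreesWithDisjunctions φ ψ m k).relabel Sum.inr) := by
  obtain ⟨n, hn⟩ := hφ
  obtain ⟨m, hm⟩ := exists_bound_disjunction k n hk
  refine ⟨m, fun ψ => ⟨m, fun N _ _ hN b a hba => ?_⟩⟩
  have hb : ∀ i j, (ψ.Realize (Sum.elim (b i) (a j)) ∧
      (agreesWithDisjunctions φ ψ m k).Realize (a j)) ↔ i ≤ j := fun i j => by
    rw [← hba i j, Formula.realize_inf, Formula.realize_relabel, Sum.elim_comp_inr]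
  have hgood : ∀ j, (agreesWithDisjunctions φ ψ m k).Realize (a j) :=
    fun j => ((hb j j).2 le_rfl).2
  choose x hx using fun j => (realize_agreesWithDisjunctions φ ψ m k (a j)).1 (hgood j) b
  refine hm _ _ (fun x y => φ.Realize (Sum.elim x y)) (hn N hN) x b fun i j => ?_
  rw [← hx j i, ← hb i j, and_iff_left (hgood j)]

open Classical in
/-- The formula `φ(x, w) ∧ ⋀ᵢ φ(x, zᵢ)^{εᵢ}` in the parameters `(w, z)`. -/
noncomputable def signedConjunction {L : FirstOrder.Language.{u, v}} {α β : Type} {r : ℕ}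
    (φ : L.Formula (α ⊕ β)) (ε : Fin r → Prop) : L.Formula (α ⊕ (β ⊕ Fin r × β)) :=
  φ.relabel (Sum.map id Sum.inl) ⊓ Formula.iInf fun i : Fin r =>
    if ε i then φ.relabel (Sum.map id fun j => Sum.inr (i, j))
    else (φ.relabel (Sum.map id fun j => Sum.inr (i, j))).not

theorem realize_signedConjunction {L : FirstOrder.Language.{u, v}} {α β : Type} {r : ℕ}
    (φ : L.Formula (α ⊕ β)) (ε : Fin r → Prop) {M : Type*} [L.Structure M] (x : α → M)
    (y : β → M) (c : Fin r × β → M) :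
    (signedConjunction φ ε).Realize (Sum.elim x (Sum.elim y c)) ↔
      φ.Realize (Sum.elim x y) ∧
        ∀ i, φ.Realize (Sum.elim x fun j => c (i, j)) ↔ ε i := by
  rw [signedConjunction, Formula.realize_inf, Formula.realize_iInf, Formula.realize_relabel,
    Sum.elim_comp_map, Sum.elim_comp_inl]
  refine and_congr Iff.rfl (forall_congr' fun i => ?_)
  split_ifs with h
  · simp only [Formula.realize_relabel, Sum.elim_comp_map, h, iff_true]
    rfl
  · simp only [Formula.realize_not, Formula.realize_relabel, Sum.elim_comp_map, h, iff_false]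
    rfl

theorem FormulaStable.relabel_right {L : FirstOrder.Language.{u, v}} {T : L.Theory}
    {α β γ : Type*} {φ : L.Formula (α ⊕ β)} (hφ : FormulaStable T φ) (f : β → γ) :
    FormulaStable T (φ.relabel (Sum.map id f)) := by
  obtain ⟨n, hn⟩ := hφ
  refine ⟨n, fun N _ _ hN b a h => hn N hN b (fun j => a j ∘ f) fun i j => ?_⟩
  rw [← h, Formula.realize_relabel, Sum.elim_comp_map, Function.comp_id]

end Formulas

/-- If `φ(x,y)` is stable in `T`, `M ⊨ T`, `A ⊆ M^y` and `p` is a `φ`-type over `A`,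
then `p` is definable over `A` by an instance of a formula `ψ(y, z)` which is stable in
`T`, with parameters `c` whose coordinates all occur as coordinates of tuples in `A`. -/
theorem stable_type_definable {L : FirstOrder.Language.{u, v}} {nx ny : ℕ}
    (T : L.Theory) (φ : L.Formula (Fin nx ⊕ Fin ny)) (hφ : FormulaStable T φ)
    (M : Type (max u v)) [L.Structure M] [Nonempty M] (hM : M ⊨ T)
    (A : Set (Fin ny → M)) (p : Set (Fin ny → M)) (hp : IsPhiType φ A p) :
    ∃ (k : ℕ) (ψ : L.Formula (Fin ny ⊕ Fin k)) (c : Fin k → M),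
      FormulaStable T ψ ∧
      (∀ i : Fin k, ∃ a ∈ A, ∃ j : Fin ny, a j = c i) ∧
      ∀ a ∈ A, (ψ.Realize (Sum.elim a c) ↔ a ∈ p) := by
  classical
  have ⟨l, hl⟩ := hφ
  obtain ⟨n, k, N, F, hk, hN, hF, hlarge, hsmall⟩ := exists_rank_multiplicity
    (R := fun (x : Fin nx → M) (y : Fin ny → M) => φ.Realize (Sum.elim x y)) (hl M hM) A p hp.2
  set R := fun (x : Fin nx → M) (y : Fin ny → M) => φ.Realize (Sum.elim x y)
  let e := F.equivFin
  let c : Fin F.card × Fin ny → M := fun q => (e.symm q.1 : Fin ny → M) q.2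
  obtain ⟨ψ, hψ⟩ := exists_formula_large φ M N n 1 _
    (signedConjunction φ fun i => (e.symm i : Fin ny → M) ∈ p)
  have hψc : ∀ y : Fin ny → M, ψ.Realize (Sum.elim y c) ↔
      Large R N n 1 ({x | ∀ a ∈ F, R x a ↔ a ∈ p} ∩ {x | R x y}) := fun y => by
    rw [hψ]
    refine iff_of_eq (congrArg (Large R N n 1) (Set.ext fun x => ?_))
    rw [Set.mem_ofPred_eq, realize_signedConjunction, and_comm]
    refine and_congr ?_ Iff.rfl
    rw [e.symm.forall_congr_left]
    simp [c, R]
  obtain ⟨m, hm⟩ := formulaStable_inf_agreesWithDisjunctions (γ := Fin F.card × Fin ny) hφ hk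
  have hgood : (agreesWithDisjunctions φ ψ m k).Realize c := by
    rw [realize_agreesWithDisjunctions]
    intro y
    obtain ⟨x, hx⟩ := Large.exists_union hN hk (hlarge F hF) hsmall (Finset.univ.image y)
    exact ⟨x, fun l => (hψc _).trans (hx _ (by simp))⟩
  let g := Fintype.equivFin (Fin F.card × Fin ny)
  refine ⟨_, _, c ∘ g.symm, (hm ψ).relabel_right g, fun i => ?_, fun a ha => ?_⟩
  · exact ⟨_, hF (e.symm (g.symm i).1).2, (g.symm i).2, rfl⟩
  have hins : ↑(insert a F) ⊆ A := by
    rw [Finset.coe_insert]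
    exact Set.insert_subset ha hF
  have hcomp : (c ∘ g.symm) ∘ g = c := by ext; simp
  rw [FirstOrder.Language.Formula.realize_relabel, Sum.elim_comp_map, Function.comp_id, hcomp,
    FirstOrder.Language.Formula.realize_inf, FirstOrder.Language.Formula.realize_relabel,
    Sum.elim_comp_inr, and_iff_left hgood, hψc]
  constructor
  · intro h
    by_contra hap
    refine hsmall (add_comm 1 k ▸ .add a h ((hlarge _ hins N hN).mono fun x hx => ?_))
    exact ⟨fun b hb => hx b (Finset.mem_insert_of_mem hb),
      fun hxa => hap ((hx a (Finset.mem_insert_self _ _)).1 hxa)⟩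
  · intro hap
    refine ((hlarge _ hins N hN).of_le le_rfl hk).mono fun x hx => ?_
    exact ⟨fun b hb => hx b (Finset.mem_insert_of_mem hb),
      (hx a (Finset.mem_insert_self _ _)).2 hap⟩
end

section
/- Let L be a first-order language and T an L-theory with definable Skolem functions, and let φ(x,y) be an L-formula that is NIP in T. Then there is an L-formula ψ(y,z), with z a finite tuple of copies of the variable tuple y, such that ψ(y,z) is itself NIP in T (with the variables partitioned as (y; z)) and ψ uniformly defines φ-types over finite sets in T: for every model M ⊨ T, every finite A ⊆ M^y with |A| ≥ 2, and every φ-type p over A, there is c ∈ A^z such that ψ(y,c) defines p. -/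
open FirstOrder Language

universe u v

/-- A family of subsets `F` of `X` shatters `B` if every subset of `B` is cut out by a
member of `F`. -/
def SetShatters {X : Type*} (F : Set (Set X)) (B : Set X) : Prop :=
  ∀ S ⊆ B, ∃ f ∈ F, f ∩ B = S

/-- The VC dimension of the family `F` is at most `n`: no finite set of size `> n` is
shattered by `F`. -/
def VCDimLE {X : Type*} (F : Set (Set X)) (n : ℕ) : Prop :=
  ∀ B : Finset X, SetShatters F ↑B → B.card ≤ n

/-- The family of definable sets `φ(M, a)` for `a ∈ M^y`. -/
def defFamily {L : FirstOrder.Language.{u, v}} {α β : Type*} (φ : L.Formula (α ⊕ β))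
    (M : Type (max u v)) [L.Structure M] : Set (Set (α → M)) :=
  { S | ∃ a : β → M, S = { b : α → M | φ.Realize (Sum.elim b a) } }

/-- `φ(x, y)` is NIP in `T`: in every model of `T`, the family of sets defined by the
instances `φ(x, a)` has finite VC dimension. -/
def FormulaNIP {L : FirstOrder.Language.{u, v}} {α β : Type*} (T : L.Theory)
    (φ : L.Formula (α ⊕ β)) : Prop :=
  ∀ (M : Type (max u v)) [L.Structure M] [Nonempty M], M ⊨ T →
    ∃ n : ℕ, VCDimLE (defFamily φ M) n

/-- `ψ(y, c)` defines the `φ`-type `p` over `A`, where `c` is a tuple of `k` elements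
of `M^y`. -/
def DefinesType {L : FirstOrder.Language.{u, v}} {β : Type*} {k : ℕ} {M : Type (max u v)}
    [L.Structure M] (ψ : L.Formula (β ⊕ (Fin k × β))) (c : Fin k → β → M)
    (A p : Set (β → M)) : Prop :=
  ∀ a ∈ A, (ψ.Realize (Sum.elim a fun iz => c iz.1 iz.2) ↔ a ∈ p)

/-- `φ(x, y)` has uniform definability of types over finite sets in `T`. -/
def UDTFS {L : FirstOrder.Language.{u, v}} {α β : Type*} (T : L.Theory)
    (φ : L.Formula (α ⊕ β)) : Prop :=
  ∃ (k : ℕ) (ψ : L.Formula (β ⊕ (Fin k × β))),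
    ∀ (M : Type (max u v)) [L.Structure M] [Nonempty M], M ⊨ T →
      ∀ A : Set (β → M), A.Finite → 2 ≤ A.ncard →
        ∀ p : Set (β → M), IsPhiType φ A p →
          ∃ c : Fin k → β → M, (∀ i, c i ∈ A) ∧ DefinesType ψ c A p

/-- `T` has definable Skolem functions: for every formula `θ(x, ȳ)` (with `x` a single
variable) there is a formula `σ(x, ȳ)` which in every model of `T` defines the graph of
a function `g` such that `g(b̄)` satisfies `θ(x, b̄)` whenever some element does. -/
def DefinableSkolem {L : FirstOrder.Language.{u, v}} (T : L.Theory) : Prop :=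
  ∀ (n : ℕ) (θ : L.Formula (Unit ⊕ Fin n)),
    ∃ σ : L.Formula (Unit ⊕ Fin n),
      ∀ (M : Type (max u v)) [L.Structure M] [Nonempty M], M ⊨ T →
        ∃ g : (Fin n → M) → M,
          (∀ (x : M) (b : Fin n → M),
            (σ.Realize (Sum.elim (fun _ => x) b) ↔ x = g b)) ∧
          ∀ b : Fin n → M, (∃ x : M, θ.Realize (Sum.elim (fun _ => x) b)) →
            θ.Realize (Sum.elim (fun _ => g b) b)

/-- The relation `R`, read as the family of sets `R j`, shatters some injective family of points
indexed by `ι`. -/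
def ShattersIndexed {X I : Type*} (R : I → X → Prop) (ι : Type*) : Prop :=
  ∃ (b : ι → X) (c : Set ι → I), ∀ S i, R (c S) (b i) ↔ i ∈ S

/-- The sets of indices cut out by the family `R` on the points `f i`. -/
def traces {X I ι : Type*} (R : I → X → Prop) (f : ι → X) : Set (Set ι) :=
  Set.range fun j => {i | R j (f i)}

/-- The shatter function of the family `R` is at most `n ↦ (n + 1) ^ d`. -/
def TraceBound {X I : Type*} (R : I → X → Prop) (d : ℕ) : Prop :=
  ∀ (ι : Type) [Fintype ι] (f : ι → X), (traces R f).ncard ≤ (Fintype.card ι + 1) ^ d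

theorem ShattersIndexed.mono {X I ι κ : Type*} {R : I → X → Prop} (h : ShattersIndexed R ι)
    (e : κ ↪ ι) : ShattersIndexed R κ := by
  obtain ⟨b, c, hbc⟩ := h
  exact ⟨b ∘ e, fun S => c (e '' S), fun S i => by simp [hbc]⟩

theorem ShattersIndexed.of_dual {X I ι : Type*} {R : I → X → Prop}
    (h : ShattersIndexed (fun x j => R j x) (Set ι)) : ShattersIndexed R ι := by
  obtain ⟨b, c, hbc⟩ := h
  exact ⟨fun i => c {S | i ∈ S}, b, fun S i => by simp [hbc]⟩

theorem ShattersIndexed.of_xor {X I ι : Type*} {R : I → X → Prop} {p : X → Prop}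
    (h : ShattersIndexed (fun j x => ¬(R j x ↔ p x)) ι) : ShattersIndexed R ι := by
  obtain ⟨b, c, hbc⟩ := h
  refine ⟨b, fun S => c {i | ¬(i ∈ S ↔ p (b i))}, fun S i => ?_⟩
  have := hbc {i | ¬(i ∈ S ↔ p (b i))} i
  simp only [Set.mem_ofPred_eq] at this
  tauto

theorem ShattersIndexed.of_comp_point {X Y I ι : Type*} {R : I → X → Prop} {f : Y → X}
    (h : ShattersIndexed (fun j y => R j (f y)) ι) : ShattersIndexed R ι := by
  obtain ⟨b, c, hbc⟩ := h
  exact ⟨f ∘ b, c, hbc⟩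

theorem ShattersIndexed.of_comp_index {X I J ι : Type*} {R : I → X → Prop} {f : J → I}
    (h : ShattersIndexed (fun j x => R (f j) x) ι) : ShattersIndexed R ι := by
  obtain ⟨b, c, hbc⟩ := h
  exact ⟨b, f ∘ c, hbc⟩

theorem not_shattersIndexed_dual {X I : Type*} {R : I → X → Prop} {d : ℕ}
    (h : ¬ShattersIndexed R (Fin d)) : ¬ShattersIndexed (fun x j => R j x) (Fin (2 ^ d + 1)) := by
  intro h'
  obtain ⟨e⟩ : Nonempty (Set (Fin d) ↪ Fin (2 ^ d + 1)) :=
    Function.Embedding.nonempty_of_card_le (by simp)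
  exact h (h'.mono e).of_dual

theorem sum_Iic_choose_le (n d : ℕ) : ∑ k ∈ Finset.Iic d, n.choose k ≤ (n + 1) ^ d := by
  rw [add_pow, Nat.range_succ_eq_Iic]
  refine Finset.sum_le_sum fun k hk => ?_
  have h1 : n.choose k ≤ n ^ k := Nat.choose_le_pow n k
  have h2 : 0 < d.choose k := Nat.choose_pos (Finset.mem_Iic.1 hk)
  simp only [one_pow, mul_one]
  exact h1.trans (Nat.le_mul_of_pos_right _ h2)

theorem traceBound_of_not_shattersIndexed {X I : Type*} {R : I → X → Prop} {d : ℕ}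
    (h : ¬ShattersIndexed R (Fin (d + 1))) : TraceBound R d := by
  classical
  intro ι _ f
  let 𝒜 : Finset (Finset ι) := Finset.univ.filter fun s => (s : Set ι) ∈ traces R f
  have hcard : (traces R f).ncard = 𝒜.card := by
    rw [← Set.ncard_coe_finset 𝒜]
    symm
    refine Set.ncard_congr (fun s _ => (s : Set ι)) ?_ ?_ ?_
    · intro s hs
      simpa [𝒜] using hs
    · intro s t _ _ hst
      exact Finset.coe_injective hst
    · intro S hS
      exact ⟨S.toFinset, by simpa [𝒜] using hS, by simp⟩
  have hdim : 𝒜.vcDim ≤ d := by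
    refine Finset.sup_le fun s hs => ?_
    by_contra! hlt
    rw [Finset.mem_shatterer] at hs
    obtain ⟨e⟩ : Nonempty (Fin (d + 1) ↪ s) :=
      Function.Embedding.nonempty_of_card_le (by simpa using hlt)
    refine h (ShattersIndexed.mono (ι := s) ?_ e)
    have key : ∀ S : Set s, ∃ j, ∀ i : s, R j (f i) ↔ i ∈ S := by
      intro S
      obtain ⟨u, hu, hsu⟩ := hs (t := S.toFinset.map (Function.Embedding.subtype _))
        (fun x hx => by
          obtain ⟨y, -, rfl⟩ := Finset.mem_map.1 hx
          exact y.2)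
      obtain ⟨j, hj⟩ : (u : Set ι) ∈ traces R f := by simpa [𝒜] using hu
      refine ⟨j, fun i => ?_⟩
      have h1 : R j (f i) ↔ (i : ι) ∈ u := by
        rw [← Finset.mem_coe, ← hj]
        rfl
      have h2 : (i : ι) ∈ s ∩ u ↔ i ∈ S := by
        rw [hsu]
        simp
      rw [h1, ← h2]
      simp
    choose c hc using key
    exact ⟨fun i => f i, c, fun S i => hc S i⟩
  calc (traces R f).ncard = 𝒜.card := hcard
    _ ≤ 𝒜.shatterer.card := 𝒜.card_le_card_shatterer
    _ ≤ ∑ k ∈ Finset.Iic 𝒜.vcDim, (Fintype.card ι).choose k :=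
        Finset.card_shatterer_le_sum_vcDim
    _ ≤ ∑ k ∈ Finset.Iic d, (Fintype.card ι).choose k :=
        Finset.sum_le_sum_of_subset (Finset.Iic_subset_Iic.2 hdim)
    _ ≤ _ := sum_Iic_choose_le _ _

theorem exists_halving_threshold (d : ℕ) {ε : ℝ} (hε : 0 < ε) :
    ∃ K : ℕ, 10 * (9 / 10 : ℝ) ^ K ≤ ε ∧ ∀ k ≥ K,
      2 * (((2 : ℝ) ^ (k + 1) + 1) ^ d) < Real.exp (2 * 2 ^ k * ((9 / 10) ^ k) ^ 2) := by
  have h1 : Filter.Tendsto (fun k : ℕ => 10 * (9 / 10 : ℝ) ^ k) Filter.atTop (nhds (10 * 0)) :=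
    (tendsto_pow_atTop_nhds_zero_of_lt_one (by norm_num) (by norm_num)).const_mul 10
  have h2 : Filter.Tendsto
      (fun k : ℕ => (d : ℝ) * ((k : ℝ) * (50 / 81 : ℝ) ^ k) + (2 * d + 1) * (50 / 81 : ℝ) ^ k)
      Filter.atTop (nhds (d * 0 + (2 * d + 1) * 0)) :=
    ((tendsto_self_mul_const_pow_of_lt_one (by norm_num) (by norm_num)).const_mul _).add
      ((tendsto_pow_atTop_nhds_zero_of_lt_one (by norm_num) (by norm_num)).const_mul _)
  have e1 := h1.eventually_le_const (u := ε) (by simpa using hε)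
  have e2 := h2.eventually_le_const (u := 2) (by norm_num)
  obtain ⟨K, hK⟩ := Filter.eventually_atTop.1 (e1.and e2)
  refine ⟨K, (hK K le_rfl).1, fun k hk => ?_⟩
  have hk2 := (hK k hk).2
  have hle : ((k + 2) * d + 1 : ℝ) ≤ 2 * 2 ^ k * ((9 / 10) ^ k) ^ 2 := by
    have hr : (2 : ℝ) ^ k * ((9 / 10) ^ k) ^ 2 = (81 / 50) ^ k := by
      rw [← pow_mul, mul_comm k 2, pow_mul, ← mul_pow]
      norm_num
    have hinv : (50 / 81 : ℝ) ^ k * (81 / 50) ^ k = 1 := by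
      rw [← mul_pow]
      norm_num
    have hpos : (0 : ℝ) < (81 / 50) ^ k := by positivity
    calc ((k + 2) * d + 1 : ℝ)
        = (d * (k * (50 / 81 : ℝ) ^ k) + (2 * d + 1) * (50 / 81 : ℝ) ^ k) * (81 / 50) ^ k := by
          linear_combination -((k + 2) * d + 1 : ℝ) * hinv
      _ ≤ 2 * (81 / 50) ^ k := by gcongr
      _ = _ := by rw [mul_assoc, hr]
  calc 2 * (((2 : ℝ) ^ (k + 1) + 1) ^ d) ≤ 2 * ((2 ^ (k + 2)) ^ d) := by
        gcongr
        have : (1 : ℝ) ≤ 2 ^ (k + 1) := one_le_pow₀ (by norm_num)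
        rw [pow_succ 2 (k + 1)]
        linarith
    _ = 2 ^ ((k + 2) * d + 1) := by rw [← pow_mul, pow_succ, mul_comm]
    _ < Real.exp 1 ^ ((k + 2) * d + 1) := by
        gcongr
        exact Real.exp_one_gt_two
    _ = Real.exp ((k + 2) * d + 1) := by
        rw [← Real.exp_nat_mul]
        push_cast
        ring_nf
    _ ≤ _ := Real.exp_le_exp.2 hle

open Classical in
/-- The fraction of the values of `f` that lie in the set `s`. -/
noncomputable def density {X ι : Type*} [Fintype ι] (f : ι → X) (s : X → Prop) : ℝ :=
  (∑ i, if s (f i) then 1 else 0) / Fintype.card ι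

theorem sum_exp_sign_le {ι : Type*} [Fintype ι] [DecidableEq ι] (a : ι → ℝ)
    (ha : ∀ i, |a i| ≤ 1) (l : ℝ) :
    ∑ s : ι → Bool, Real.exp (l * ∑ i, (if s i then a i else -a i)) ≤
      2 ^ Fintype.card ι * Real.exp (Fintype.card ι * (l ^ 2 / 2)) := by
  have h : ∀ s : ι → Bool, Real.exp (l * ∑ i, (if s i then a i else -a i)) =
      ∏ i, Real.exp (l * (if s i then a i else -a i)) := fun s => by
    rw [← Real.exp_sum, Finset.mul_sum]
  simp_rw [h]
  rw [← Fintype.prod_sum (fun (i : ι) (b : Bool) => Real.exp (l * (if b then a i else -a i)))]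
  have h2 : ∀ i, ∑ b : Bool, Real.exp (l * (if b then a i else -a i)) ≤
      2 * Real.exp (l ^ 2 / 2) := by
    intro i
    have h3 := Real.cosh_le_exp_half_sq (l * a i)
    rw [Real.cosh_eq] at h3
    have h4 : (l * a i) ^ 2 ≤ l ^ 2 := by
      rw [mul_pow]
      have : (a i) ^ 2 ≤ 1 := by rw [← sq_abs]; nlinarith [ha i, abs_nonneg (a i)]
      nlinarith [sq_nonneg l]
    have h5 : Real.exp ((l * a i) ^ 2 / 2) ≤ Real.exp (l ^ 2 / 2) := by gcongr
    simp only [Fintype.univ_bool, Finset.mem_singleton, Bool.true_eq_false, not_false_eq_true,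
      Finset.sum_insert, Finset.sum_singleton, if_true, Bool.false_eq_true, if_false, mul_neg]
    linarith
  calc _ ≤ ∏ _i : ι, (2 * Real.exp (l ^ 2 / 2)) :=
        Finset.prod_le_prod (fun i _ => Finset.sum_nonneg fun b _ => (Real.exp_pos _).le)
          fun i _ => h2 i
    _ = _ := by
        rw [Finset.prod_const, mul_pow, Finset.card_univ, ← Real.exp_nat_mul]

/-- A simultaneous Hoeffding bound for finitely many sign sums. -/
theorem exists_sign_abs_sum_le {ι τ : Type*} [Fintype ι] [Fintype τ] (a : τ → ι → ℝ)
    (ha : ∀ t i, |a t i| ≤ 1) {δ : ℝ} (hδ : 0 < δ)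
    (h : 2 * (Fintype.card τ : ℝ) < Real.exp (2 * Fintype.card ι * δ ^ 2)) :
    ∃ s : ι → Bool, ∀ t, |∑ i, (if s i then a t i else -a t i)| ≤ 2 * Fintype.card ι * δ := by
  classical
  set n : ℝ := (Fintype.card ι : ℝ) with hn
  by_contra! hcon
  set E : ℝ → τ → (ι → Bool) → ℝ := fun l t s =>
    Real.exp (l * ∑ i, (if s i then a t i else -a t i)) with hE
  have hlow : ∀ s : ι → Bool, Real.exp (4 * n * δ ^ 2) ≤
      ∑ t, (E (2 * δ) t s + E (-(2 * δ)) t s) := by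
    intro s
    obtain ⟨t, ht⟩ := hcon s
    refine le_trans ?_ (Finset.single_le_sum (f := fun t => E (2 * δ) t s + E (-(2 * δ)) t s)
      (fun t _ => (add_pos (Real.exp_pos _) (Real.exp_pos _)).le) (Finset.mem_univ t))
    simp only [hE]
    rcases lt_abs.1 ht with h1 | h1
    · refine le_trans (Real.exp_le_exp.2 ?_) (le_add_of_nonneg_right (Real.exp_pos _).le)
      nlinarith
    · refine le_trans (Real.exp_le_exp.2 ?_) (le_add_of_nonneg_left (Real.exp_pos _).le)
      nlinarith
  have hsum := Finset.sum_le_sum fun s (_ : s ∈ (Finset.univ : Finset (ι → Bool))) => hlow s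
  rw [Finset.sum_comm] at hsum
  have hup : ∀ t, ∑ s, (E (2 * δ) t s + E (-(2 * δ)) t s) ≤
      2 ^ Fintype.card ι * (2 * Real.exp (2 * n * δ ^ 2)) := by
    intro t
    rw [Finset.sum_add_distrib]
    have h1 := sum_exp_sign_le (a t) (ha t) (2 * δ)
    have h2 := sum_exp_sign_le (a t) (ha t) (-(2 * δ))
    have e1 : n * ((2 * δ) ^ 2 / 2) = 2 * n * δ ^ 2 := by ring
    have e2 : n * ((-(2 * δ)) ^ 2 / 2) = 2 * n * δ ^ 2 := by ring
    rw [← hn, e1] at h1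
    rw [← hn, e2] at h2
    linarith
  have hsum2 := hsum.trans (Finset.sum_le_sum fun t _ => hup t)
  simp only [Finset.sum_const, Finset.card_univ, nsmul_eq_mul, Fintype.card_fun,
    Fintype.card_bool] at hsum2
  push_cast at hsum2
  have e4 : Real.exp (4 * n * δ ^ 2) = Real.exp (2 * n * δ ^ 2) * Real.exp (2 * n * δ ^ 2) := by
    rw [← Real.exp_add]; ring_nf
  rw [e4] at hsum2
  have hp : (0 : ℝ) < 2 ^ Fintype.card ι * Real.exp (2 * n * δ ^ 2) := by positivity
  nlinarith

theorem density_comp_equiv {X ι κ : Type*} [Fintype ι] [Fintype κ] (e : κ ≃ ι) (f : ι → X)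
    (s : X → Prop) : density (f ∘ e) s = density f s := by
  classical
  unfold density
  rw [Fintype.card_congr e]
  congr 1
  exact Equiv.sum_comp e fun i => if s (f i) then (1 : ℝ) else 0

theorem exists_halving {X I : Type*} {R : I → X → Prop} {d : ℕ} (hR : TraceBound R d)
    {ι : Type} [Fintype ι] [Nonempty ι] (f : ι × Bool → X) {δ : ℝ} (hδ : 0 < δ)
    (h : 2 * ((2 * (Fintype.card ι : ℝ) + 1) ^ d) < Real.exp (2 * Fintype.card ι * δ ^ 2)) :
    ∃ g : ι → X, ∀ j, |density g (R j) - density f (R j)| ≤ δ := by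
  classical
  let χ : X → I → ℝ := fun x j => if R j x then 1 else 0
  have : Fintype (traces R f) := Fintype.ofFinite _
  let μ : traces R f → ι × Bool → ℝ := fun t i => if i ∈ (t : Set (ι × Bool)) then 1 else 0
  obtain ⟨s, hs⟩ := exists_sign_abs_sum_le (fun t i => μ t (i, true) - μ t (i, false))
    (fun t i => by
      simp only [μ]
      split_ifs <;> norm_num) hδ (by
      refine lt_of_le_of_lt ?_ h
      have := hR _ f
      rw [← Nat.card_coe_set_eq, Nat.card_eq_fintype_card] at this
      simp only [Fintype.card_prod, Fintype.card_bool] at this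
      have h3 : (Fintype.card (traces R f) : ℝ) ≤ ((Fintype.card ι * 2 + 1 : ℕ) : ℝ) ^ d := by
        exact_mod_cast this
      push_cast at h3
      rw [mul_comm (Fintype.card ι : ℝ)] at h3
      linarith)
  refine ⟨fun i => f (i, s i), fun j => ?_⟩
  have hn : (0 : ℝ) < Fintype.card ι := by exact_mod_cast Fintype.card_pos
  have hj := hs ⟨{i | R j (f i)}, j, rfl⟩
  have key : density (fun i => f (i, s i)) (R j) - density f (R j) =
      (∑ i, (if s i then χ (f (i, true)) j - χ (f (i, false)) j
        else -(χ (f (i, true)) j - χ (f (i, false)) j))) / (2 * Fintype.card ι) := by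
    have h1 : density (fun i => f (i, s i)) (R j) = (∑ i, χ (f (i, s i)) j) / Fintype.card ι := by
      unfold density
      congr!
    have h2 : density f (R j) =
        (∑ i, (χ (f (i, true)) j + χ (f (i, false)) j)) / (2 * Fintype.card ι) := by
      unfold density
      rw [Fintype.sum_prod_type, Fintype.card_prod, Fintype.card_bool, Nat.cast_mul, mul_comm]
      simp only [Fintype.sum_bool, χ]
      congr!
    rw [h1, h2, div_sub_div _ _ hn.ne' (by positivity),
      div_eq_div_iff (by positivity) (by positivity)]
    have h3 : ∑ i, (if s i then χ (f (i, true)) j - χ (f (i, false)) j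
        else -(χ (f (i, true)) j - χ (f (i, false)) j)) =
        2 * ∑ i, χ (f (i, s i)) j - ∑ i, (χ (f (i, true)) j + χ (f (i, false)) j) := by
      rw [Finset.mul_sum, ← Finset.sum_sub_distrib]
      refine Finset.sum_congr rfl fun i _ => ?_
      cases s i <;> simp <;> ring
    rw [h3]
    ring
  rw [key, abs_div, abs_of_pos (by positivity : (0 : ℝ) < 2 * Fintype.card ι),
    div_le_iff₀ (by positivity)]
  simp only [μ, Set.mem_ofPred_eq] at hj
  simp only [χ]
  convert hj using 1
  · congr!
  · ring

/-- Families with polynomial shatter function have bounded approximations. -/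
theorem exists_approximation (d : ℕ) {ε : ℝ} (hε : 0 < ε) :
    ∃ K : ℕ, ∀ {X I : Type*} {R : I → X → Prop}, TraceBound R d → ∀ k ≥ K,
      ∀ f : Fin (2 ^ k) → X, ∃ g : Fin (2 ^ K) → X,
        ∀ j, |density g (R j) - density f (R j)| ≤ ε := by
  obtain ⟨K, hK, hk⟩ := exists_halving_threshold d hε
  refine ⟨K, fun {X I R} hR => ?_⟩
  suffices H : ∀ k ≥ K, ∀ f : Fin (2 ^ k) → X, ∃ g : Fin (2 ^ K) → X,
      ∀ j, |density g (R j) - density f (R j)| ≤ 10 * (9 / 10 : ℝ) ^ K - 10 * (9 / 10) ^ k by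
    intro k hkK f
    obtain ⟨g, hg⟩ := H k hkK f
    refine ⟨g, fun j => (hg j).trans ?_⟩
    have : (0 : ℝ) < (9 / 10) ^ k := by positivity
    linarith
  intro k hkK
  induction k, hkK using Nat.le_induction with
  | base => exact fun f => ⟨f, fun j => by simp⟩
  | succ k hkK ih =>
    intro f
    have e : Fin (2 ^ k) × Bool ≃ Fin (2 ^ (k + 1)) :=
      Fintype.equivOfCardEq (by simp [pow_succ])
    obtain ⟨g, hg⟩ := exists_halving hR (f ∘ e) (δ := (9 / 10) ^ k) (by positivity) (by
      have := hk k hkK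
      rw [pow_succ, mul_comm ((2 : ℝ) ^ k)] at this
      simpa using this)
    obtain ⟨g', hg'⟩ := ih g
    refine ⟨g', fun j => ?_⟩
    have h1 := hg j
    rw [density_comp_equiv] at h1
    have h2 := abs_sub_le (density g' (R j)) (density g (R j)) (density f (R j))
    have h3 := hg' j
    have h4 : (9 / 10 : ℝ) ^ (k + 1) = (9 / 10) ^ k * (9 / 10) := pow_succ _ _
    linarith

open Classical in
/-- Weak `1/5`-nets for weighted points. -/
theorem exists_net (d : ℕ) :
    ∃ s : ℕ, ∀ {X I : Type*} {R : I → X → Prop}, TraceBound R d → ∀ [Fintype X] (w : X → ℕ),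
      0 < ∑ x, w x → ∃ Z : Fin s → X, ∀ j, (∀ i, ¬R j (Z i)) →
        5 * ∑ x, (if R j x then w x else 0) ≤ ∑ x, w x := by
  obtain ⟨K, hK⟩ := exists_approximation d (ε := 1 / 10) (by norm_num)
  refine ⟨2 ^ K, fun {X I R} hR _ w hw => ?_⟩
  let β := Σ x, Fin (w x * 2 ^ K)
  set N := (∑ x, w x) * 2 ^ K with hN
  have hβ : Fintype.card β = N := by simp [β, hN, Finset.sum_mul]
  have hKN : 2 ^ K ≤ N := Nat.le_mul_of_pos_left _ hw
  have hN0 : N ≠ 0 := (lt_of_lt_of_le (by positivity) hKN).ne'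
  set k := Nat.log 2 N + 1
  have h1 : N < 2 ^ k := Nat.lt_pow_succ_log_self (by norm_num) N
  have h2 : 2 ^ k ≤ 2 * N := by
    have := Nat.pow_log_le_self 2 hN0
    rw [pow_succ]
    lia
  have hk : K ≤ k := ((Nat.pow_lt_pow_iff_right (by norm_num)).1 (hKN.trans_lt h1)).le
  obtain ⟨e⟩ : Nonempty (β ↪ Fin (2 ^ k)) :=
    Function.Embedding.nonempty_of_card_le (by simpa [hβ] using h1.le)
  obtain ⟨x₀⟩ : Nonempty X := by
    by_contra hX
    rw [not_nonempty_iff] at hX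
    simp at hw
  obtain ⟨g, hg⟩ := hK hR k hk (Function.extend e Sigma.fst fun _ => x₀)
  refine ⟨g, fun j hj => ?_⟩
  have hg0 : density g (R j) = 0 := by
    simp [density, hj]
  have hgj := hg j
  rw [hg0, zero_sub, abs_neg] at hgj
  have hgj := (le_abs_self _).trans hgj
  set c : ℕ := ∑ x, (if R j x then w x else 0) with hc
  have hsum : (c * 2 ^ K : ℝ) ≤ ∑ i, if R j (Function.extend e Sigma.fst (fun _ => x₀) i)
      then (1 : ℝ) else 0 := by
    calc (c * 2 ^ K : ℝ) = ∑ b : β, if R j b.1 then (1 : ℝ) else 0 := by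
          rw [Fintype.sum_sigma, hc]
          push_cast
          rw [Finset.sum_mul]
          refine Finset.sum_congr rfl fun x _ => ?_
          by_cases hx : R j x <;> simp [hx]
      _ = ∑ i ∈ Finset.univ.map e, if R j (Function.extend e Sigma.fst (fun _ => x₀) i)
            then (1 : ℝ) else 0 := by
          rw [Finset.sum_map]
          refine Finset.sum_congr rfl fun b _ => ?_
          rw [e.injective.extend_apply]
      _ ≤ _ := Finset.sum_le_univ_sum_of_nonneg fun i => by split_ifs <;> norm_num
  unfold density at hgj
  rw [div_le_iff₀ (by simp)] at hgj
  simp only [Fintype.card_fin, Nat.cast_pow, Nat.cast_ofNat] at hgj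
  have h2' : (2 : ℝ) ^ k ≤ 2 * ((∑ x, w x : ℕ) * 2 ^ K) := by
    rw [hN] at h2
    exact_mod_cast h2
  have hfin : (c * 2 ^ K : ℝ) ≤ 1 / 10 * (2 * ((∑ x, w x : ℕ) * 2 ^ K)) := by
    refine (hsum.trans ?_).trans (mul_le_mul_of_nonneg_left h2' (by norm_num))
    convert hgj
  have hp : (0 : ℝ) < 2 ^ K := by positivity
  have : (5 * c : ℝ) ≤ (∑ x, w x : ℕ) := by
    refine le_of_mul_le_mul_right ?_ hp
    linarith
  exact_mod_cast this

open Classical in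
/-- Boosting: weak hypotheses for every weight combine into a sequence of hypotheses that is
correct at least two thirds of the time at every point. -/
theorem exists_boosting {X Z : Type*} [Fintype X] [Nonempty X] (bad : Z → X → Prop)
    (h : ∀ w : X → ℕ, 0 < ∑ x, w x → ∃ z, 5 * ∑ x, (if bad z x then w x else 0) ≤ ∑ x, w x) :
    ∃ t₀, ∀ t ≥ t₀, ∃ f : Fin t → Z, ∀ x, 3 * ∑ i, (if bad (f i) x then 1 else 0) ≤ t := by
  have key : ∀ t : ℕ, ∃ f : Fin t → Z,
      5 ^ t * ∑ x, 2 ^ (∑ i, (if bad (f i) x then 1 else 0)) ≤ 6 ^ t * Fintype.card X := by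
    intro t
    induction t with
    | zero => exact ⟨Fin.elim0, by simp⟩
    | succ t ih =>
      obtain ⟨f, hf⟩ := ih
      obtain ⟨z, hz⟩ := h (fun x => 2 ^ (∑ i, (if bad (f i) x then 1 else 0)))
        (Finset.sum_pos (fun x _ => by positivity) Finset.univ_nonempty)
      refine ⟨Fin.cons z f, ?_⟩
      have h1 : ∀ x, 2 ^ (∑ i : Fin (t + 1),
          (if bad ((Fin.cons z f : Fin (t + 1) → Z) i) x then 1 else 0)) =
          2 ^ (∑ i, (if bad (f i) x then 1 else 0)) +
            if bad z x then 2 ^ (∑ i, (if bad (f i) x then 1 else 0)) else 0 := by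
        intro x
        rw [Fin.sum_univ_succ]
        by_cases hb : bad z x
        · simp [hb, pow_add]
          ring
        · simp [hb]
      simp_rw [h1, Finset.sum_add_distrib]
      have h2 := Nat.mul_le_mul_left (5 ^ t) hz
      rw [pow_succ, pow_succ, mul_add]
      linarith
  set n := Fintype.card X
  have hlim := (tendsto_pow_atTop_nhds_zero_of_lt_one (r := (216 / 250 : ℝ)) (by norm_num)
    (by norm_num)).mul_const ((n : ℝ) ^ 3)
  rw [zero_mul] at hlim
  obtain ⟨t₀, ht₀⟩ := Filter.eventually_atTop.1 (hlim.eventually_lt_const zero_lt_one)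
  refine ⟨t₀, fun t ht => ?_⟩
  obtain ⟨f, hf⟩ := key t
  refine ⟨f, fun x => ?_⟩
  set b := ∑ i, (if bad (f i) x then 1 else 0) with hb
  by_contra! hlt
  have h1 : 5 ^ t * 2 ^ b ≤ 6 ^ t * n := by
    refine le_trans (Nat.mul_le_mul_left _ ?_) hf
    exact Finset.single_le_sum (f := fun x => 2 ^ (∑ i, (if bad (f i) x then 1 else 0)))
      (fun _ _ => Nat.zero_le _) (Finset.mem_univ x)
  have h2 : (5 ^ t * 2 ^ b) ^ 3 ≤ (6 ^ t * n) ^ 3 := Nat.pow_le_pow_left h1 3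
  have h3 : 2 ^ t ≤ (2 ^ b) ^ 3 := by
    rw [← pow_mul, mul_comm]
    exact Nat.pow_le_pow_right (by norm_num) hlt.le
  have h4 : 250 ^ t ≤ 216 ^ t * n ^ 3 := by
    calc 250 ^ t = (5 ^ t) ^ 3 * 2 ^ t := by
          rw [← pow_mul, mul_comm t 3, pow_mul, ← mul_pow]
          norm_num
      _ ≤ (5 ^ t) ^ 3 * (2 ^ b) ^ 3 := Nat.mul_le_mul_left _ h3
      _ = (5 ^ t * 2 ^ b) ^ 3 := (mul_pow _ _ _).symm
      _ ≤ (6 ^ t * n) ^ 3 := h2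
      _ = 216 ^ t * n ^ 3 := by
          rw [mul_pow, ← pow_mul, mul_comm t 3, pow_mul]
          norm_num
  have h5 := ht₀ t ht
  have h6 : (250 : ℝ) ^ t ≤ 216 ^ t * n ^ 3 := by exact_mod_cast h4
  rw [div_pow, div_mul_eq_mul_div, div_lt_one (by positivity)] at h5
  linarith

/-- Sample compression by majority vote. -/
theorem exists_compression (d d' : ℕ) :
    ∃ s N : ℕ, ∀ {X I : Type u} [Fintype X] [Nonempty X] {R : I → X → Prop} {p : X → Prop}
      (_ : TraceBound (fun j x => ¬(R j x ↔ p x)) d) (_ : TraceBound (fun x j => R j x) d')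
      (H : (Fin s → X) → I) (_ : ∀ Z i, R (H Z) (Z i) ↔ p (Z i)),
      ∃ Z : Fin N → Fin s → X, ∀ x,
        p x ↔ ∃ S : Finset (Fin N), N < 2 * S.card ∧ ∀ i ∈ S, R (H (Z i)) x := by
  classical
  obtain ⟨s, hs⟩ := exists_net.{u, u} d
  obtain ⟨K, hK⟩ := exists_approximation.{u, u} d' (ε := 1 / 10) (by norm_num)
  refine ⟨s, 2 ^ K, fun {X I} _ _ R p hR hR' H hH => ?_⟩
  obtain ⟨t₀, ht₀⟩ := exists_boosting (fun (Z : Fin s → X) x => ¬(R (H Z) x ↔ p x))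
    fun w hw => by
      obtain ⟨Z, hZ⟩ := hs hR w hw
      refine ⟨Z, ?_⟩
      convert hZ (H Z) fun i => not_not.2 (hH Z i)
  obtain ⟨k, hkK, hkt⟩ : ∃ k ≥ K, t₀ ≤ 2 ^ k :=
    ⟨max K t₀, le_max_left _ _, (le_max_right _ _).trans Nat.lt_two_pow_self.le⟩
  obtain ⟨f, hf⟩ := ht₀ _ hkt
  have htr : TraceBound (fun x (Z : Fin s → X) => R (H Z) x) d' := fun ι _ f => hR' ι (H ∘ f)
  obtain ⟨g, hg⟩ := hK htr k hkK f
  refine ⟨g, fun x => ?_⟩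
  have hgx := abs_le.1 (hg x)
  have hcast : (3 : ℝ) * ∑ i, (if ¬(R (H (f i)) x ↔ p x) then 1 else 0) ≤ 2 ^ k := by
    have := hf x
    have h2 : ((3 * ∑ i, (if ¬(R (H (f i)) x ↔ p x) then 1 else 0) : ℕ) : ℝ) ≤ (2 ^ k : ℕ) := by
      rw [Nat.cast_le]
      convert this
    push_cast at h2
    exact h2
  have hgd : density g (fun Z => R (H Z) x) =
      ((Finset.univ.filter fun i => R (H (g i)) x).card : ℝ) / 2 ^ K := by
    unfold density
    rw [Finset.sum_boole]
    simp
  have hpk : (0 : ℝ) < 2 ^ k := by positivity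
  have hpK : (0 : ℝ) < 2 ^ K := by positivity
  by_cases hp : p x
  · simp only [hp, true_iff, iff_true] at hcast ⊢
    have hfd : density f (fun Z => R (H Z) x) =
        1 - (∑ i, (if ¬R (H (f i)) x then 1 else 0)) / 2 ^ k := by
      unfold density
      rw [eq_sub_iff_add_eq, Fintype.card_fin, Nat.cast_pow, Nat.cast_ofNat, ← add_div,
        div_eq_one_iff_eq hpk.ne', ← Finset.sum_add_distrib]
      calc _ = ∑ i : Fin (2 ^ k), (1 : ℝ) := by
            refine Finset.sum_congr rfl fun i _ => ?_
            by_cases h : R (H (f i)) x <;> simp [h]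
        _ = _ := by simp
    refine ⟨Finset.univ.filter fun i => R (H (g i)) x, ?_,
      fun i hi => (Finset.mem_filter.1 hi).2⟩
    have h3 : (∑ i, (if ¬R (H (f i)) x then (1 : ℝ) else 0)) / 2 ^ k ≤ 1 / 3 := by
      rw [div_le_iff₀ hpk]
      linarith
    have h4 : 1 / 2 < ((Finset.univ.filter fun i => R (H (g i)) x).card : ℝ) / 2 ^ K := by
      rw [← hgd]
      linarith [hgx.1]
    rw [lt_div_iff₀ hpK] at h4
    have : (2 ^ K : ℝ) < 2 * (Finset.univ.filter fun i => R (H (g i)) x).card := by linarith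
    exact_mod_cast this
  · simp only [hp, iff_false, not_not, false_iff] at hcast ⊢
    rintro ⟨S, hS, hSx⟩
    have hfd : density f (fun Z => R (H Z) x) =
        (∑ i, (if R (H (f i)) x then 1 else 0)) / 2 ^ k := by
      unfold density
      simp
    have h3 : (∑ i, (if R (H (f i)) x then (1 : ℝ) else 0)) / 2 ^ k ≤ 1 / 3 := by
      rw [div_le_iff₀ hpk]
      linarith
    have h4 : ((Finset.univ.filter fun i => R (H (g i)) x).card : ℝ) / 2 ^ K < 1 / 2 := by
      rw [← hgd]
      linarith [hgx.2]
    rw [div_lt_iff₀ hpK] at h4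
    have h5 : S.card ≤ (Finset.univ.filter fun i => R (H (g i)) x).card :=
      Finset.card_le_card fun i hi => Finset.mem_filter.2 ⟨Finset.mem_univ _, hSx i hi⟩
    have h6 : ((2 ^ K : ℕ) : ℝ) < (2 * S.card : ℕ) := Nat.cast_lt.2 hS
    have h7 : (S.card : ℝ) ≤ (Finset.univ.filter fun i => R (H (g i)) x).card := Nat.cast_le.2 h5
    push_cast at h6
    linarith

/-- Boolean combinations of boundedly many members of a family with polynomial shatter function
have finite VC dimension. -/
theorem exists_not_shattersIndexed_of_boolean {X I : Type*} (d N : ℕ) :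
    ∃ n : ℕ, ∀ {R : I → X → Prop}, TraceBound R d → ∀ {J : Type*} {Q : J → X → Prop}
      (B : Set (Fin N) → Prop),
      (∀ j, ∃ i : Fin N → I, ∀ x, Q j x ↔ B {t | R (i t) x}) → ¬ShattersIndexed Q (Fin n) := by
  have hlim := tendsto_pow_const_div_const_pow_of_one_lt (d * N) (r := (2 : ℝ)) (by norm_num)
  obtain ⟨m, hm1, hm⟩ := ((Filter.eventually_ge_atTop 1).and
    (hlim.eventually_lt_const (u := 1 / 2) (by norm_num))).exists
  obtain ⟨n, rfl⟩ : ∃ n, m = n + 1 := ⟨m - 1, by lia⟩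
  refine ⟨n, fun {R} hR {J Q} B hB ⟨b, c, hbc⟩ => ?_⟩
  have h1 : Set.univ ⊆ Set.range
      (fun T : Fin N → traces R b => {i | B {t | i ∈ (T t : Set (Fin n))}}) := by
    intro S _
    obtain ⟨i, hi⟩ := hB (c S)
    refine ⟨fun t => ⟨_, i t, rfl⟩, ?_⟩
    ext a
    rw [← hbc S a, hi]
    rfl
  have h2 := Set.ncard_le_ncard h1
  rw [Set.ncard_univ, ← Nat.card_coe_set_eq] at h2
  have h3 := h2.trans (Finite.card_range_le _)
  have h4 := hR _ b
  rw [← Nat.card_coe_set_eq] at h4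
  have h5 : 2 ^ n ≤ ((n + 1) ^ d) ^ N := by
    have : Nat.card (Set (Fin n)) = 2 ^ n := by simp [Nat.card_eq_fintype_card]
    rw [← this]
    refine h3.trans ?_
    rw [Nat.card_fun]
    simpa using Nat.pow_le_pow_left h4 N
  rw [← pow_mul] at h5
  rw [div_lt_iff₀ (by positivity), pow_succ] at hm
  have h6 : (2 : ℝ) ^ n ≤ ((n + 1 : ℕ) : ℝ) ^ (d * N) := by exact_mod_cast h5
  linarith

section ModelTheory

variable {L : FirstOrder.Language.{u, v}}

/-- The relation defined by a partitioned formula, read as a family of sets indexed by the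
parameters. -/
def instanceRel {α β : Type*} (φ : L.Formula (α ⊕ β)) (M : Type (max u v)) [L.Structure M]
    (a : β → M) (b : α → M) : Prop :=
  φ.Realize (Sum.elim b a)

theorem vcDimLE_of_not_shattersIndexed {α β : Type*} {φ : L.Formula (α ⊕ β)}
    {M : Type (max u v)} [L.Structure M] {n : ℕ}
    (h : ¬ShattersIndexed (instanceRel φ M) (Fin n)) : VCDimLE (defFamily φ M) n := by
  intro B hB
  by_contra! hlt
  obtain ⟨e⟩ : Nonempty (Fin n ↪ B) :=
    Function.Embedding.nonempty_of_card_le (by simpa using hlt.le)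
  refine h (ShattersIndexed.mono (ι := B) ?_ e)
  have key : ∀ S : Set B, ∃ a, ∀ b : B, instanceRel φ M a b ↔ b ∈ S := by
    intro S
    obtain ⟨_, ⟨a, rfl⟩, ha⟩ := hB (Subtype.val '' S) (by
      rintro _ ⟨b, -, rfl⟩
      exact b.2)
    refine ⟨a, fun b => ?_⟩
    have h1 := Set.ext_iff.1 ha b
    simpa [instanceRel] using h1
  choose c hc using key
  exact ⟨Subtype.val, c, hc⟩

theorem not_shattersIndexed_of_vcDimLE {α β : Type*} {φ : L.Formula (α ⊕ β)}
    {M : Type (max u v)} [L.Structure M] {n : ℕ} (h : VCDimLE (defFamily φ M) n) :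
    ¬ShattersIndexed (instanceRel φ M) (Fin (n + 1)) := by
  classical
  rintro ⟨b, c, hbc⟩
  have hinj : Function.Injective b := by
    intro i j hij
    have h1 := hbc {i} i
    rw [hij, hbc] at h1
    exact (h1.2 rfl).symm
  have h1 := h (Finset.univ.map ⟨b, hinj⟩) (by
    intro S hS
    refine ⟨_, ⟨c (b ⁻¹' S), rfl⟩, ?_⟩
    ext x
    constructor
    · rintro ⟨hx, hxB⟩
      obtain ⟨i, -, rfl⟩ := Finset.mem_map.1 hxB
      exact (hbc (b ⁻¹' S) i).1 hx
    · intro hx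
      obtain ⟨i, -, rfl⟩ := Finset.mem_map.1 (hS hx)
      exact ⟨(hbc (b ⁻¹' S) i).2 hx, hS hx⟩)
  simp at h1

/-- By compactness, the VC dimension of a NIP formula is bounded uniformly over all models. -/
theorem FormulaNIP.exists_uniform_bound {α β : Type*} {T : L.Theory} {φ : L.Formula (α ⊕ β)}
    (hφ : FormulaNIP T φ) :
    ∃ d : ℕ, ∀ (M : Type (max u v)) [L.Structure M] [Nonempty M], M ⊨ T →
      ¬ShattersIndexed (instanceRel φ M) (Fin (d + 1)) := by
  by_contra! hcon
  choose M hS hN hM hsh using hcon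
  choose b c hbc using hsh
  let U := (Filter.hyperfilter ℕ : Filter ℕ).Product M
  have hU : U ⊨ T := ⟨fun σ hσ => by
    refine (FirstOrder.Language.Ultraproduct.sentence_realize σ).2 (Filter.Eventually.of_forall
      fun d => ?_)
    have := hM d
    exact FirstOrder.Language.Theory.realize_sentence_of_mem T hσ⟩
  obtain ⟨n, hn⟩ := hφ U hU
  refine not_shattersIndexed_of_vcDimLE hn ?_
  let b' : Fin (n + 1) → α → ∀ d, M d := fun i a d =>
    if h : n + 1 ≤ d + 1 then b d (Fin.castLE h i) a else Classical.arbitrary _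
  let c' : Set (Fin (n + 1)) → β → ∀ d, M d := fun S a d =>
    if h : n + 1 ≤ d + 1 then c d (Fin.castLE h '' S) a else Classical.arbitrary _
  refine ⟨fun i a => (b' i a : U), fun S a => (c' S a : U), fun S i => ?_⟩
  have h1 : (Sum.elim (fun a => (b' i a : U)) (fun a => (c' S a : U))) =
      fun z => ((Sum.elim (b' i) (c' S) z : ∀ d, M d) : U) := by
    ext z
    cases z <;> rfl
  have h2 : ∀ d ≥ n, (φ.Realize (fun z => Sum.elim (b' i) (c' S) z d) ↔ i ∈ S) := by
    intro d hd
    have hd' : n + 1 ≤ d + 1 := by lia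
    have h3 := hbc d (Fin.castLE hd' '' S) (Fin.castLE hd' i)
    rw [(Fin.castLE_injective hd').mem_set_image] at h3
    rw [← h3]
    unfold instanceRel
    congr! 1
    ext z
    cases z <;> simp [b', c', hd]
  have h4 : ∀ᶠ d in (Filter.hyperfilter ℕ : Filter ℕ), n ≤ d :=
    Nat.hyperfilter_le_atTop (Filter.eventually_ge_atTop n)
  have h5 : φ.Realize (fun z => ((Sum.elim (b' i) (c' S) z : ∀ d, M d) :
      (Filter.hyperfilter ℕ : Filter ℕ).Product M)) ↔ i ∈ S := by
    rw [FirstOrder.Language.Ultraproduct.realize_formula_cast,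
      Filter.eventually_congr (h4.mono h2), Filter.eventually_const]
  exact (iff_of_eq (congrArg φ.Realize h1)).trans h5

/-- Definable Skolem functions for several variables and arbitrary finite parameter tuples. -/
theorem DefinableSkolem.exists_skolem {T : L.Theory} (hT : DefinableSkolem T) :
    ∀ (m : ℕ) {γ : Type} [Finite γ] (θ : L.Formula (Fin m ⊕ γ)),
      ∃ σ : L.Formula (Fin m ⊕ γ),
        ∀ (M : Type (max u v)) [L.Structure M] [Nonempty M], M ⊨ T →
          ∃ g : (γ → M) → (Fin m → M),
            (∀ x c, σ.Realize (Sum.elim x c) ↔ x = g c) ∧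
            ∀ c, (∃ x, θ.Realize (Sum.elim x c)) → θ.Realize (Sum.elim (g c) c) := by
  intro m
  induction m with
  | zero =>
    intro γ _ θ
    refine ⟨⊤, fun M _ _ _ => ⟨fun _ => Fin.elim0, fun x c => ?_, fun c ⟨x, hx⟩ => ?_⟩⟩
    · simp [Subsingleton.elim x Fin.elim0]
    · rwa [Subsingleton.elim x Fin.elim0] at hx
  | succ m ih =>
    intro γ _ θ
    obtain ⟨n, ⟨e⟩⟩ := Finite.exists_equiv_fin γ
    let r : Fin (m + 1) ⊕ γ → Fin m ⊕ (Unit ⊕ γ) :=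
      Sum.elim (Fin.cases (Sum.inr (Sum.inl ())) Sum.inl) (Sum.inr ∘ Sum.inr)
    have hr : ∀ (M : Type (max u v)) (x₀ : M) (x : Fin m → M) (c : γ → M),
        Sum.elim x (Sum.elim (fun _ => x₀) c) ∘ r = Sum.elim (Fin.cons x₀ x) c := by
      intro M x₀ x c
      ext z
      rcases z with i | z
      · refine Fin.cases ?_ (fun i => ?_) i <;> simp [r]
      · simp [r]
    let θ₁ : L.Formula (Fin m ⊕ (Unit ⊕ γ)) := θ.relabel r
    let θ₀ : L.Formula ((Unit ⊕ γ) ⊕ Fin m) := θ₁.relabel Sum.swap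
    have hθ₀ : ∀ (M : Type (max u v)) [L.Structure M] (x₀ : M) (c : γ → M),
        ((θ₀.iExs (Fin m)).relabel (Sum.map id e)).Realize
          (Sum.elim (fun _ => x₀) (c ∘ e.symm)) ↔
          ∃ x : Fin m → M, θ.Realize (Sum.elim (Fin.cons x₀ x) c) := by
      intro M _ x₀ c
      rw [FirstOrder.Language.Formula.realize_relabel, FirstOrder.Language.Formula.realize_iExs]
      refine exists_congr fun x => ?_
      have h1 : (Sum.elim (Sum.elim (fun _ : Unit => x₀) (c ∘ e.symm) ∘ Sum.map id e) x) ∘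
          Sum.swap = Sum.elim x (Sum.elim (fun _ : Unit => x₀) c) := by
        ext z
        rcases z with i | i | i <;> simp
      rw [FirstOrder.Language.Formula.realize_relabel, FirstOrder.Language.Formula.realize_relabel,
        h1, hr]
    obtain ⟨σ₀, hσ₀⟩ := hT n ((θ₀.iExs (Fin m)).relabel (Sum.map id e))
    obtain ⟨σ₁, hσ₁⟩ := ih θ₁
    refine ⟨(σ₀.relabel (Sum.elim (fun _ => Sum.inl 0) (Sum.inr ∘ e.symm))) ⊓
      σ₁.relabel (Sum.elim (Sum.inl ∘ Fin.succ)
        (Sum.elim (fun _ => Sum.inl 0) Sum.inr)), fun M _ _ hM => ?_⟩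
    obtain ⟨g₀, hg₀, hg₀'⟩ := hσ₀ M hM
    obtain ⟨g₁, hg₁, hg₁'⟩ := hσ₁ M hM
    refine ⟨fun c => Fin.cons (g₀ (c ∘ e.symm))
      (g₁ (Sum.elim (fun _ => g₀ (c ∘ e.symm)) c)), fun x c => ?_, fun c ⟨x, hx⟩ => ?_⟩
    · beta_reduce
      have e₀ : Sum.elim x c ∘ (Sum.elim (fun _ => Sum.inl 0) (Sum.inr ∘ e.symm)) =
          Sum.elim (fun _ : Unit => x 0) (c ∘ e.symm) := by
        ext z
        cases z <;> rfl
      have e₁ : Sum.elim x c ∘ (Sum.elim (Sum.inl ∘ Fin.succ)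
          (Sum.elim (fun _ => Sum.inl 0) Sum.inr)) =
          Sum.elim (fun i : Fin m => x i.succ) (Sum.elim (fun _ : Unit => x 0) c) := by
        ext z
        rcases z with i | i | i <;> rfl
      rw [FirstOrder.Language.Formula.realize_inf, FirstOrder.Language.Formula.realize_relabel,
        FirstOrder.Language.Formula.realize_relabel, e₀, e₁, hg₀, hg₁]
      constructor
      · rintro ⟨h0, h1⟩
        rw [← h0, ← h1]
        exact (Fin.cons_self_tail x).symm
      · intro h
        have h0 : x 0 = g₀ (c ∘ e.symm) := by rw [h, Fin.cons_zero]
        refine ⟨h0, ?_⟩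
        rw [h0]
        funext i
        rw [h, Fin.cons_succ]
    · have h0 := (hθ₀ M _ c).1 (hg₀' (c ∘ e.symm) ⟨x 0, (hθ₀ M _ c).2 ⟨Fin.tail x, by
        rwa [Fin.cons_self_tail]⟩⟩)
      obtain ⟨x', hx'⟩ := h0
      have h1 := hg₁' (Sum.elim (fun _ => g₀ (c ∘ e.symm)) c) ⟨x', by
        rw [FirstOrder.Language.Formula.realize_relabel, hr]
        exact hx'⟩
      rw [FirstOrder.Language.Formula.realize_relabel, hr] at h1
      exact h1

end ModelTheory

/-- If `T` has definable Skolem functions and `φ(x,y)` is NIP in `T`, then some formula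
`ψ(y,z)` which is itself NIP in `T` uniformly defines `φ`-types over finite sets. -/
theorem nip_udtfs_of_definableSkolem {L : FirstOrder.Language.{u, v}} {nx ny : ℕ}
    (T : L.Theory) (hT : DefinableSkolem T)
    (φ : L.Formula (Fin nx ⊕ Fin ny)) (hφ : FormulaNIP T φ) :
    ∃ (k : ℕ) (ψ : L.Formula (Fin ny ⊕ (Fin k × Fin ny))),
      FormulaNIP T ψ ∧
      ∀ (M : Type (max u v)) [L.Structure M] [Nonempty M], M ⊨ T →
        ∀ A : Set (Fin ny → M), A.Finite → 2 ≤ A.ncard →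
          ∀ p : Set (Fin ny → M), IsPhiType φ A p →
            ∃ c : Fin k → Fin ny → M, (∀ i, c i ∈ A) ∧ DefinesType ψ c A p := by
  obtain ⟨d, hd⟩ := hφ.exists_uniform_bound
  obtain ⟨s, N, hsN⟩ := exists_compression.{max u v} (2 ^ (d + 1)) d
  let γ := Fin s × Fin 3 × Fin ny
  let θ : L.Formula (Fin nx ⊕ γ) := Formula.iInf fun i : Fin s =>
    (φ.relabel (Sum.map id fun j => ((i, 0, j) : γ))).iff
      (Formula.iInf fun j : Fin ny =>
        (Term.var (Sum.inr (i, 1, j))).equal (Term.var (Sum.inr (i, 2, j))))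
  have hθ : ∀ (M : Type (max u v)) [L.Structure M] (x : Fin nx → M) (c : γ → M),
      θ.Realize (Sum.elim x c) ↔ ∀ i, (instanceRel φ M (fun j => c (i, 0, j)) x ↔
        ∀ j, c (i, 1, j) = c (i, 2, j)) := by
    intro M _ x c
    have h1 : ∀ i, Sum.elim x c ∘ Sum.map id (fun j => ((i, 0, j) : γ)) =
        Sum.elim x fun j => c (i, 0, j) := fun i => by
      ext z
      cases z <;> rfl
    simp [θ, instanceRel, h1]
  obtain ⟨σ, hσ⟩ := hT.exists_skolem nx θ
  let χ : L.Formula (Fin ny ⊕ γ) :=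
    (σ.relabel (Sum.elim Sum.inr (Sum.inl ∘ Sum.inr)) ⊓
      φ.relabel (Sum.elim Sum.inr (Sum.inl ∘ Sum.inl))).iExs (Fin nx)
  have hχ : ∀ (M : Type (max u v)) [L.Structure M] (y : Fin ny → M) (c : γ → M),
      χ.Realize (Sum.elim y c) ↔ ∃ x, σ.Realize (Sum.elim x c) ∧ instanceRel φ M y x := by
    intro M _ y c
    have h1 : ∀ x : Fin nx → M, Sum.elim (Sum.elim y c) x ∘
        Sum.elim Sum.inr (Sum.inl ∘ Sum.inr) = Sum.elim x c := fun x => by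
      ext z
      cases z <;> rfl
    have h2 : ∀ x : Fin nx → M, Sum.elim (Sum.elim y c) x ∘
        Sum.elim Sum.inr (Sum.inl ∘ Sum.inl) = Sum.elim x y := fun x => by
      ext z
      cases z <;> rfl
    simp [χ, instanceRel, h1, h2]
  obtain ⟨k, ⟨e⟩⟩ := Finite.exists_equiv_fin (Fin N × Fin s × Fin 3)
  let ψ : L.Formula (Fin ny ⊕ (Fin k × Fin ny)) :=
    Formula.iSup fun S : {S : Finset (Fin N) // N < 2 * S.card} =>
      Formula.iInf fun t : {t // t ∈ S.1} =>
        χ.relabel (Sum.map id fun q : γ => (e (t, q.1, q.2.1), q.2.2))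
  have hψ : ∀ (M : Type (max u v)) [L.Structure M] (y : Fin ny → M) (c : Fin k × Fin ny → M),
      ψ.Realize (Sum.elim y c) ↔ ∃ S : Finset (Fin N), N < 2 * S.card ∧ ∀ t ∈ S,
        ∃ x, σ.Realize (Sum.elim x fun q : γ => c (e (t, q.1, q.2.1), q.2.2)) ∧
          instanceRel φ M y x := by
    intro M _ y c
    have h1 : ∀ t : Fin N, Sum.elim y c ∘
        Sum.map id (fun q : γ => (e (t, q.1, q.2.1), q.2.2)) =
        Sum.elim y fun q : γ => c (e (t, q.1, q.2.1), q.2.2) := fun t => by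
      ext z
      cases z <;> rfl
    simp [ψ, h1, hχ]
  have hdual : ∀ (M : Type (max u v)) [L.Structure M] [Nonempty M], M ⊨ T →
      TraceBound (fun x y => instanceRel φ M y x) (2 ^ (d + 1)) := fun M _ _ hM =>
    traceBound_of_not_shattersIndexed (not_shattersIndexed_dual (hd M hM))
  refine ⟨k, ψ, fun M _ _ hM => ?_, fun M _ _ hM A hA hA2 p hp => ?_⟩
  · obtain ⟨g, hg, -⟩ := hσ M hM
    obtain ⟨n, hn⟩ := exists_not_shattersIndexed_of_boolean (X := Fin ny → M)
      (I := Fin nx → M) (2 ^ (d + 1)) N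
    refine ⟨n, vcDimLE_of_not_shattersIndexed (hn (hdual M hM)
      (fun V => ∃ S : Finset (Fin N), N < 2 * S.card ∧ ∀ t ∈ S, t ∈ V) fun c => ?_)⟩
    refine ⟨fun t => g fun q => c (e (t, q.1, q.2.1), q.2.2), fun y => ?_⟩
    rw [instanceRel, hψ]
    simp [hg]
  · classical
    obtain ⟨g, hg, hg'⟩ := hσ M hM
    obtain ⟨a₀, ha₀, a₁, ha₁, hne⟩ := (Set.one_lt_ncard hA).1 hA2
    obtain ⟨b₀, hb₀⟩ := hp.2 hA.toFinset (by simp)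
    have := hA.fintype
    have : Nonempty A := ⟨a₀, ha₀⟩
    let code : (Fin s → A) → Fin s → Fin 3 → A := fun Z i =>
      ![Z i, ⟨a₀, ha₀⟩, if (Z i : Fin ny → M) ∈ p then ⟨a₀, ha₀⟩ else ⟨a₁, ha₁⟩]
    let H : (Fin s → A) → Fin nx → M := fun Z =>
      g fun q => (code Z q.1 q.2.1 : Fin ny → M) q.2.2
    have hcode : ∀ Z i, (∀ j, (code Z i 1 : Fin ny → M) j = (code Z i 2 : Fin ny → M) j) ↔
        (Z i : Fin ny → M) ∈ p := by
      intro Z i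
      rw [← funext_iff]
      by_cases h : (Z i : Fin ny → M) ∈ p <;> simp [code, h, hne]
    have hH : ∀ Z i, instanceRel φ M (Z i) (H Z) ↔ (Z i : Fin ny → M) ∈ p := by
      intro Z i
      have h1 := hg' (fun q => (code Z q.1 q.2.1 : Fin ny → M) q.2.2) ⟨b₀, (hθ M _ _).2
        fun i => (hb₀ _ (by simp [code])).trans (hcode Z i).symm⟩
      exact ((hθ M _ _).1 h1 i).trans (hcode Z i)
    obtain ⟨Z, hZ⟩ := hsN (X := A) (I := Fin nx → M)
      (R := fun x a => instanceRel φ M a x) (p := fun a => (a : Fin ny → M) ∈ p)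
      (traceBound_of_not_shattersIndexed fun h =>
        not_shattersIndexed_dual (hd M hM) h.of_xor.of_comp_point)
      (traceBound_of_not_shattersIndexed fun h => hd M hM h.of_comp_index) H hH
    refine ⟨fun l => code (Z (e.symm l).1) (e.symm l).2.1 (e.symm l).2.2,
      fun l => Subtype.coe_prop _, fun a ha => ?_⟩
    rw [hψ, hZ ⟨a, ha⟩]
    simp [hg, H]
end
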